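/- arXiv:0811.0557 — 2 statements merged into one kernel-verified Lean document; each statement's English description precedes it below -/
import Mathlib

section
/- Let m, n ∈ ℕ with m ≥ 2 and n ≥ 2, m even and n odd. Then the Tornheim double series satisfies T(m,0,n) = ζ(m) ζ(n) − (1/2) ζ(m+n) + (−1)^{⌊(m+n)/2⌋} ((2π)^{m+n−1}/(m! n!)) · ( −m·I_AA(m−1,n) − n·I_AA(m,n−1) − m·J_AA(m−1,n) + n·J_AA(m,n−1) ). -/
open Real MeasureTheory

/-- Hurwitz zeta as a real-valued function of real arguments. -/
noncomputable def hzeta (z q : ℝ) : ℝ := (HurwitzZeta.hurwitzZeta (q : UnitAddCircle) (z : ℂ)).re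

/-- Riemann zeta as a real-valued function of a real argument. -/
noncomputable def rzeta (s : ℝ) : ℝ := (riemannZeta (s : ℂ)).re

/-- Tornheim double series. -/
noncomputable def T (a b c : ℝ) : ℝ :=
  ∑' r : ℕ+, ∑' s : ℕ+, 1 / ((r : ℝ) ^ a * (s : ℝ) ^ b * ((r : ℝ) + (s : ℝ)) ^ c)

/-- Bernoulli polynomial evaluated at a real. -/
noncomputable def B (k : ℕ) (q : ℝ) : ℝ := Polynomial.aeval q (Polynomial.bernoulli k)

/-- The Bernoulli function `A_k(q) = k ζ'(1-k, q)`. -/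
noncomputable def A (k : ℕ) (q : ℝ) : ℝ :=
  k * (deriv (fun z : ℂ => HurwitzZeta.hurwitzZeta (q : UnitAddCircle) z) (1 - (k : ℂ))).re

/-- The kernel `K(q) = log sin (π q)`. -/
noncomputable def K (q : ℝ) : ℝ := Real.log (Real.sin (π * q))

noncomputable def I_AB (k l : ℕ) : ℝ := (1 / π) * ∫ q in (0:ℝ)..1, A k q * B l q * K q

noncomputable def I_BB (k l : ℕ) : ℝ := ∫ q in (0:ℝ)..1, B k q * B l q * K q

noncomputable def I_AA (k l : ℕ) : ℝ := (1 / π ^ 2) * ∫ q in (0:ℝ)..1, A k q * A l q * K q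

noncomputable def J_AA (k l : ℕ) : ℝ := (1 / π ^ 2) * ∫ q in (0:ℝ)..1, A k q * A l (1 - q) * K q

/-- The increments `(j+1)^(-s) - (j+2)^(-s)`, used for summation by parts. -/
noncomputable def cpowIncr (j : ℕ) (s : ℂ) : ℂ := ((j : ℂ) + 1) ^ (-s) - ((j : ℂ) + 2) ^ (-s)

/-- The character `q ↦ exp (2 * π * i * q)`. -/
noncomputable def circleExp (q : ℝ) : ℂ := Complex.exp (2 * π * Complex.I * q)

lemma norm_cpowIncr_le (j : ℕ) {s : ℂ} (hs : 0 < s.re) :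
    ‖cpowIncr j s‖ ≤ ‖s‖ * ((j : ℝ) + 1) ^ (-s.re - 1) := by
  have hs0 : -s ≠ 0 := by
    intro h
    have : s = 0 := by simpa using h
    simp [this] at hs
  have hj : (0 : ℝ) < j + 1 := by positivity
  have hd : ∀ x ∈ Set.Icc ((j : ℝ) + 1) (j + 2),
      HasDerivWithinAt (fun x : ℝ => (x : ℂ) ^ (-s)) (-s * (x : ℂ) ^ (-s - 1))
        (Set.Icc ((j : ℝ) + 1) (j + 2)) x := fun x hx =>
    (hasDerivAt_ofReal_cpow_const (by linarith [hx.1]) hs0).hasDerivWithinAt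
  have hb : ∀ x ∈ Set.Icc ((j : ℝ) + 1) (j + 2),
      ‖-s * (x : ℂ) ^ (-s - 1)‖ ≤ ‖s‖ * ((j : ℝ) + 1) ^ (-s.re - 1) := by
    intro x hx
    have hx0 : 0 < x := by linarith [hx.1]
    rw [norm_mul, norm_neg, Complex.norm_cpow_eq_rpow_re_of_pos hx0]
    simp only [Complex.sub_re, Complex.neg_re, Complex.one_re]
    exact mul_le_mul_of_nonneg_left (Real.rpow_le_rpow_of_nonpos hj hx.1 (by linarith))
      (norm_nonneg _)
  have h := (convex_Icc ((j : ℝ) + 1) (j + 2)).norm_image_sub_le_of_norm_hasDerivWithin_le hd hb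
    (Set.left_mem_Icc.2 (by linarith)) (Set.right_mem_Icc.2 (by linarith))
  rw [cpowIncr, norm_sub_rev]
  have h1 : ‖(j : ℝ) + 2 - (j + 1)‖ = 1 := by norm_num
  rw [h1, mul_one] at h
  simpa using h

lemma differentiable_cpowIncr (j : ℕ) : Differentiable ℂ (cpowIncr j) := by
  unfold cpowIncr
  have h1 : ((j : ℂ) + 1) ≠ 0 := by exact_mod_cast Nat.succ_ne_zero j
  have h2 : ((j : ℂ) + 2) ≠ 0 := by exact_mod_cast Nat.succ_ne_zero (j + 1)
  exact (differentiable_id.neg.const_cpow (Or.inl h1)).sub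
    (differentiable_id.neg.const_cpow (Or.inl h2))

lemma norm_cpowIncr_le_of_le (j : ℕ) {s : ℂ} {M : ℝ} (hs : 7 / 8 ≤ s.re) (hM : ‖s‖ ≤ M) :
    ‖cpowIncr j s‖ ≤ M * ((j : ℝ) + 1) ^ (-15 / 8 : ℝ) := by
  refine (norm_cpowIncr_le j (by linarith)).trans ?_
  have : (1 : ℝ) ≤ j + 1 := by linarith [j.cast_nonneg (α := ℝ)]
  have h0 : 0 ≤ M := (norm_nonneg _).trans hM
  gcongr
  linarith

lemma summable_add_one_rpow {p : ℝ} (hp : p < -1) : Summable fun j : ℕ => ((j : ℝ) + 1) ^ p := by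
  have := (summable_nat_add_iff 1).2 (Real.summable_nat_rpow.2 hp)
  simpa using this

lemma natCast_re_ge {k : ℕ} (hk : 1 ≤ k) : (7 / 8 : ℝ) ≤ (k : ℂ).re := by
  have : (1 : ℝ) ≤ k := by exact_mod_cast hk
  simp; linarith

lemma summable_weighted {c : ℕ → ℂ} {M : ℝ}
    (hc : ∀ j, ‖c j‖ ≤ M * ((j : ℝ) + 1) ^ (-15 / 8 : ℝ)) :
    Summable fun j => ‖c j‖ * ((j : ℝ) + 1) ^ (3 / 4 : ℝ) := by
  refine Summable.of_nonneg_of_le (fun j => by positivity) (fun j => ?_)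
    ((summable_add_one_rpow (p := -9 / 8) (by norm_num)).mul_left M)
  have : (0 : ℝ) < j + 1 := by positivity
  calc ‖c j‖ * ((j : ℝ) + 1) ^ (3 / 4 : ℝ)
      ≤ M * ((j : ℝ) + 1) ^ (-15 / 8 : ℝ) * ((j : ℝ) + 1) ^ (3 / 4 : ℝ) := by gcongr; exact hc j
    _ = M * ((j : ℝ) + 1) ^ (-9 / 8 : ℝ) := by
      rw [mul_assoc, ← Real.rpow_add this]; norm_num

lemma norm_deriv_cpowIncr_le (j : ℕ) {k : ℕ} (hk : 1 ≤ k) :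
    ‖deriv (cpowIncr j) k‖ ≤ ((k + 1) * 8) * ((j : ℝ) + 1) ^ (-15 / 8 : ℝ) := by
  have h := Complex.norm_deriv_le_of_forall_mem_sphere_norm_le (f := cpowIncr j) (c := (k : ℂ))
    (R := 1 / 8) (C := (k + 1) * ((j : ℝ) + 1) ^ (-15 / 8 : ℝ)) (by norm_num)
    (differentiable_cpowIncr j).diffContOnCl (fun s hs => ?_)
  · refine h.trans_eq ?_
    ring
  · have hs' : ‖s - k‖ = 1 / 8 := by simpa using hs
    have h1 := Complex.abs_re_le_norm (s - k)
    rw [hs', abs_le] at h1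
    have hk' : (1 : ℝ) ≤ k := by exact_mod_cast hk
    have h2 := h1.1
    simp only [Complex.sub_re, Complex.natCast_re] at h2
    apply norm_cpowIncr_le_of_le _ (by linarith)
    have := norm_add_le (s - k) (k : ℂ)
    rw [sub_add_cancel, hs', Complex.norm_natCast] at this
    linarith

lemma hasSum_cpowIncr {s : ℂ} (hs : 7 / 8 ≤ s.re) : HasSum (fun j => cpowIncr j s) 1 := by
  have hsum : Summable (fun j => cpowIncr j s) :=
    Summable.of_norm_bounded ((summable_add_one_rpow (p := -15 / 8) (by norm_num)).mul_left ‖s‖)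
      (fun j => norm_cpowIncr_le_of_le j hs le_rfl)
  have h1 := hsum.hasSum.tendsto_sum_nat
  have h2 : ∀ N : ℕ, ∑ j ∈ Finset.range N, cpowIncr j s = 1 - ((N : ℂ) + 1) ^ (-s) := by
    intro N
    induction N with
    | zero => simp
    | succ N ih =>
      rw [Finset.sum_range_succ, ih, cpowIncr]
      push_cast
      ring_nf
  have h3 : Filter.Tendsto (fun N : ℕ => 1 - ((N : ℂ) + 1) ^ (-s)) Filter.atTop (nhds (1 - 0)) := by
    refine tendsto_const_nhds.sub ?_
    rw [tendsto_zero_iff_norm_tendsto_zero]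
    have h4 : ∀ N : ℕ, ‖((N : ℂ) + 1) ^ (-s)‖ = ((N + 1 : ℕ) : ℝ) ^ (-s.re) := by
      intro N
      have : ((N : ℂ) + 1) = (((N + 1 : ℕ) : ℝ) : ℂ) := by push_cast; ring
      rw [this, Complex.norm_cpow_eq_rpow_re_of_pos (by positivity)]
      simp
    simp_rw [h4]
    exact ((tendsto_rpow_neg_atTop (by linarith)).comp tendsto_natCast_atTop_atTop).comp
      (Filter.tendsto_add_atTop_nat 1)
  simp_rw [h2] at h1
  rw [sub_zero] at h3
  rw [← tendsto_nhds_unique h1 h3]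
  exact hsum.hasSum

lemma norm_circleExp (q : ℝ) : ‖circleExp q‖ = 1 := by
  rw [circleExp, show (2 * π * Complex.I * q : ℂ) = ((2 * π * q : ℝ) : ℂ) * Complex.I by
    push_cast; ring, Complex.norm_exp_ofReal_mul_I]

lemma circleExp_pow (q : ℝ) (n : ℕ) : circleExp q ^ n = circleExp (n * q) := by
  rw [circleExp, circleExp, ← Complex.exp_nat_mul]
  push_cast
  ring_nf

lemma norm_one_sub_circleExp (q : ℝ) : ‖1 - circleExp q‖ = 2 * |Real.sin (π * q)| := by
  rw [norm_sub_rev, circleExp, show (2 * π * Complex.I * q : ℂ) = Complex.I * ((2 * π * q : ℝ) : ℂ) by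
    push_cast; ring, Complex.norm_exp_I_mul_ofReal_sub_one]
  rw [norm_mul, Real.norm_eq_abs, Real.norm_eq_abs, show 2 * π * q / 2 = π * q by ring]
  norm_num

lemma abs_sin_natCast_mul_le (n : ℕ) (x : ℝ) : |Real.sin (n * x)| ≤ n * |Real.sin x| := by
  induction n with
  | zero => simp
  | succ n ih =>
    push_cast
    rw [add_mul, one_mul, Real.sin_add]
    calc _ ≤ |Real.sin (n * x) * Real.cos x| + |Real.cos (n * x) * Real.sin x| := abs_add_le _ _
      _ ≤ |Real.sin (n * x)| * 1 + 1 * |Real.sin x| := by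
        rw [abs_mul, abs_mul]
        gcongr
        · exact Real.abs_cos_le_one x
        · exact Real.abs_cos_le_one _
      _ ≤ _ := by linarith

lemma abs_sin_natCast_mul_le_rpow (n : ℕ) (x : ℝ) :
    |Real.sin (n * x)| ≤ (n : ℝ) ^ (3 / 4 : ℝ) * |Real.sin x| ^ (3 / 4 : ℝ) := by
  rw [← Real.mul_rpow (by positivity) (abs_nonneg _)]
  calc |Real.sin (n * x)| = |Real.sin (n * x)| ^ (1 : ℝ) := by simp
    _ ≤ |Real.sin (n * x)| ^ (3 / 4 : ℝ) :=
      Real.rpow_le_rpow_of_exponent_ge_of_imp (abs_nonneg _) (Real.abs_sin_le_one _)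
        (by norm_num) (by norm_num)
    _ ≤ _ := by
      gcongr
      exact abs_sin_natCast_mul_le n x

lemma norm_circleExp_sub_pow_le (q : ℝ) (j : ℕ) :
    ‖circleExp q - circleExp q ^ (j + 2)‖ ≤
      2 * |Real.sin (π * q)| ^ (3 / 4 : ℝ) * ((j : ℝ) + 1) ^ (3 / 4 : ℝ) := by
  have : circleExp q - circleExp q ^ (j + 2) = circleExp q * (1 - circleExp q ^ (j + 1)) := by ring
  rw [this, norm_mul, norm_circleExp, circleExp_pow, norm_one_sub_circleExp, one_mul]
  have := abs_sin_natCast_mul_le_rpow (j + 1) (π * q)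
  rw [show π * (((j + 1 : ℕ) : ℝ) * q) = ((j + 1 : ℕ) : ℝ) * (π * q) by ring]
  push_cast at this ⊢
  linarith

lemma sin_pi_mul_pos {q : ℝ} (hq : q ∈ Set.Ioo (0 : ℝ) 1) : 0 < Real.sin (π * q) :=
  Real.sin_pos_of_pos_of_lt_pi (mul_pos Real.pi_pos hq.1)
    (by nlinarith [Real.pi_pos, hq.2])

lemma one_sub_circleExp_ne_zero {q : ℝ} (hq : q ∈ Set.Ioo (0 : ℝ) 1) : 1 - circleExp q ≠ 0 := by
  rw [← norm_pos_iff, norm_one_sub_circleExp]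
  have := sin_pi_mul_pos hq
  positivity

lemma coe_unitAddCircle_ne_zero {q : ℝ} (hq : q ∈ Set.Ioo (0 : ℝ) 1) : (q : UnitAddCircle) ≠ 0 := by
  intro h
  obtain ⟨n, hn⟩ := (AddCircle.coe_eq_zero_iff 1).1 h
  simp only [zsmul_eq_mul, mul_one] at hn
  have h1 := hq.1
  have h2 := hq.2
  rw [← hn] at h1 h2
  have h3 : (0 : ℤ) < n := by exact_mod_cast h1
  have h4 : n < (1 : ℤ) := by exact_mod_cast h2
  omega

/-- Abel summation of the periodic zeta function: `(1 - z) * expZeta q s` as a series with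
increments of `n ^ (-s)` as coefficients. -/
noncomputable def abelSeries (c : ℕ → ℂ) (q : ℝ) : ℂ :=
  ∑' j : ℕ, (circleExp q - circleExp q ^ (j + 2)) * c j

lemma abelSeries_eq_of_one_lt_re (q : ℝ) {s : ℂ} (hs : 1 < s.re) :
    abelSeries (fun j => cpowIncr j s) q =
      (1 - circleExp q) * HurwitzZeta.expZeta q s := by
  have h0 := HurwitzZeta.hasSum_expZeta_of_one_lt_re q hs
  have hs0 : s ≠ 0 := by
    intro h
    norm_num [h] at hs
  have ht : (fun n : ℕ => Complex.exp (2 * π * Complex.I * q * n) / (n : ℂ) ^ s) =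
      fun n : ℕ => circleExp q ^ n * (n : ℂ) ^ (-s) := by
    ext n
    rw [circleExp, ← Complex.exp_nat_mul, Complex.cpow_neg, div_eq_mul_inv]
    ring_nf
  rw [ht] at h0
  have h1 : HasSum (fun j : ℕ => circleExp q ^ (j + 1) * ((j : ℂ) + 1) ^ (-s))
      (HurwitzZeta.expZeta q s) := by
    have := (hasSum_nat_add_iff' 1).2 h0
    simpa [hs0] using this
  have h2 : HasSum (fun j : ℕ => circleExp q ^ (j + 2) * ((j : ℂ) + 2) ^ (-s))
      (HurwitzZeta.expZeta q s - circleExp q) := by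
    have := (hasSum_nat_add_iff' 1).2 h1
    simp only [Finset.sum_range_one] at this
    convert! this using 2 with j
    · push_cast
      ring_nf
    · simp
  have h3 := ((hasSum_cpowIncr (by linarith : 7 / 8 ≤ s.re)).mul_left (circleExp q)).sub
    ((h1.mul_left (circleExp q)).sub h2)
  rw [abelSeries]
  convert! h3.tsum_eq using 1
  · congr 1
    ext j
    simp only [cpowIncr]
    ring
  · ring

lemma norm_abel_term_le (q : ℝ) (j : ℕ) (c : ℂ) :
    ‖(circleExp q - circleExp q ^ (j + 2)) * c‖ ≤ 2 * ‖c‖ := by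
  rw [norm_mul]
  gcongr
  refine (norm_sub_le _ _).trans ?_
  rw [norm_pow, norm_circleExp]
  norm_num

lemma differentiableOn_abelSeries (q : ℝ) (M : ℝ) :
    DifferentiableOn ℂ (fun s => abelSeries (fun j => cpowIncr j s) q)
      ({s | 7 / 8 < s.re} ∩ Metric.ball 0 M) := by
  refine Complex.differentiableOn_tsum_of_summable_norm
    (u := fun j : ℕ => 2 * (M * ((j : ℝ) + 1) ^ (-15 / 8 : ℝ)))
    (((summable_add_one_rpow (by norm_num)).mul_left M).mul_left 2)
    (fun j => ((differentiable_cpowIncr j).const_mul _).differentiableOn) ?_ ?_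
  · exact (isOpen_lt continuous_const Complex.continuous_re).inter Metric.isOpen_ball
  · intro j s hs
    refine (norm_abel_term_le _ _ _).trans ?_
    gcongr
    exact norm_cpowIncr_le_of_le j (le_of_lt hs.1) (mem_ball_zero_iff.1 hs.2).le

lemma abelSeries_cpowIncr_eqOn {q : ℝ} (hq : q ∈ Set.Ioo (0 : ℝ) 1) (M : ℝ) (hM : 3 < M) :
    Set.EqOn (fun s => abelSeries (fun j => cpowIncr j s) q)
      (fun s => (1 - circleExp q) * HurwitzZeta.expZeta q s)
      ({s | 7 / 8 < s.re} ∩ Metric.ball 0 M) := by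
  have ho : IsOpen ({s : ℂ | 7 / 8 < s.re} ∩ Metric.ball 0 M) :=
    (isOpen_lt continuous_const Complex.continuous_re).inter Metric.isOpen_ball
  have hd : Differentiable ℂ (fun s => (1 - circleExp q) * HurwitzZeta.expZeta q s) :=
    (HurwitzZeta.differentiable_expZeta_of_ne_zero (coe_unitAddCircle_ne_zero hq)).const_mul _
  refine AnalyticOnNhd.eqOn_of_preconnected_of_eventuallyEq (z₀ := 2)
    ((differentiableOn_abelSeries q M).analyticOnNhd ho) (hd.differentiableOn.analyticOnNhd ho)
    ?_ ?_ ?_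
  · exact ((convex_halfSpace_re_gt _).inter (convex_ball _ _)).isPreconnected
  · constructor
    · norm_num
    · simp; linarith
  · have : {s : ℂ | 1 < s.re} ∈ nhds (2 : ℂ) :=
      (isOpen_lt continuous_const Complex.continuous_re).mem_nhds (by norm_num)
    filter_upwards [this] with s hs
    exact abelSeries_eq_of_one_lt_re q hs

lemma natCast_mem_region {k : ℕ} (hk : 1 ≤ k) :
    (k : ℂ) ∈ {s : ℂ | 7 / 8 < s.re} ∩ Metric.ball 0 ((k : ℝ) + 3) := by
  have : (1 : ℝ) ≤ k := by exact_mod_cast hk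
  constructor
  · simp; linarith
  · simp

lemma expZeta_eq_abelSeries {q : ℝ} (hq : q ∈ Set.Ioo (0 : ℝ) 1) {k : ℕ} (hk : 1 ≤ k) :
    HurwitzZeta.expZeta q k = (1 - circleExp q)⁻¹ * abelSeries (fun j => cpowIncr j k) q := by
  have hk' : (1 : ℝ) ≤ k := by exact_mod_cast hk
  have := abelSeries_cpowIncr_eqOn hq (k + 3) (by linarith) (natCast_mem_region hk)
  simp only at this
  rw [this, inv_mul_cancel_left₀ (one_sub_circleExp_ne_zero hq)]

lemma deriv_expZeta_eq_abelSeries {q : ℝ} (hq : q ∈ Set.Ioo (0 : ℝ) 1) {k : ℕ} (hk : 1 ≤ k) :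
    deriv (HurwitzZeta.expZeta q) k =
      (1 - circleExp q)⁻¹ * abelSeries (fun j => deriv (cpowIncr j) k) q := by
  have hk' : (1 : ℝ) ≤ k := by exact_mod_cast hk
  have ho : IsOpen ({s : ℂ | 7 / 8 < s.re} ∩ Metric.ball 0 ((k : ℝ) + 3)) :=
    (isOpen_lt continuous_const Complex.continuous_re).inter Metric.isOpen_ball
  have h1 := ((abelSeries_cpowIncr_eqOn hq (k + 3) (by linarith)).eventuallyEq_of_mem
    (ho.mem_nhds (natCast_mem_region hk))).deriv_eq
  have h2 := Complex.hasSum_deriv_of_summable_norm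
    (F := fun j s => (circleExp q - circleExp q ^ (j + 2)) * cpowIncr j s)
    (u := fun j : ℕ => 2 * (((k : ℝ) + 3) * ((j : ℝ) + 1) ^ (-15 / 8 : ℝ)))
    (((summable_add_one_rpow (by norm_num)).mul_left _).mul_left 2)
    (fun j => ((differentiable_cpowIncr j).const_mul _).differentiableOn) ho
    (fun j s hs => (norm_abel_term_le _ _ _).trans (by
      gcongr
      exact norm_cpowIncr_le_of_le j (le_of_lt hs.1) (mem_ball_zero_iff.1 hs.2).le))
    (natCast_mem_region hk)
  have h3 : abelSeries (fun j => deriv (cpowIncr j) k) q =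
      deriv (fun s => abelSeries (fun j => cpowIncr j s) q) k := by
    rw [abelSeries]
    unfold abelSeries
    rw [← h2.tsum_eq]
    congr 1
    ext j
    rw [deriv_const_mul _ (differentiable_cpowIncr j _)]
  rw [h3, h1, deriv_const_mul _
    (HurwitzZeta.differentiable_expZeta_of_ne_zero (coe_unitAddCircle_ne_zero hq) _),
    inv_mul_cancel_left₀ (one_sub_circleExp_ne_zero hq)]

lemma continuous_circleExp : Continuous circleExp := by
  unfold circleExp
  fun_prop

lemma continuous_abelSeries {c : ℕ → ℂ} (hc : Summable fun j => ‖c j‖) :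
    Continuous (abelSeries c) := by
  refine continuous_tsum (u := fun j => 2 * ‖c j‖) (fun j => ?_) (hc.mul_left 2)
    (fun j q => norm_abel_term_le q j (c j))
  have := continuous_circleExp
  fun_prop

lemma norm_abelSeries_le {c : ℕ → ℂ} (hc : Summable fun j => ‖c j‖ * ((j : ℝ) + 1) ^ (3 / 4 : ℝ))
    (q : ℝ) : ‖abelSeries c q‖ ≤ 2 * (∑' j, ‖c j‖ * ((j : ℝ) + 1) ^ (3 / 4 : ℝ)) *
      |Real.sin (π * q)| ^ (3 / 4 : ℝ) := by
  have h : HasSum (fun j => 2 * |Real.sin (π * q)| ^ (3 / 4 : ℝ) *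
      (‖c j‖ * ((j : ℝ) + 1) ^ (3 / 4 : ℝ))) _ := hc.hasSum.mul_left _
  refine (tsum_of_norm_bounded h (fun j => ?_)).trans_eq (by ring)
  rw [norm_mul]
  calc _ ≤ (2 * |Real.sin (π * q)| ^ (3 / 4 : ℝ) * ((j : ℝ) + 1) ^ (3 / 4 : ℝ)) * ‖c j‖ := by
        gcongr
        exact norm_circleExp_sub_pow_le q j
    _ = _ := by ring

/-- Functions which are continuous on `(0, 1)` and grow at the endpoints at most like the power
`-1/4` of the distance to them. -/
def MildEndpoints {E : Type*} [NormedAddCommGroup E] (f : ℝ → E) : Prop :=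
  ContinuousOn f (Set.Ioo 0 1) ∧
    ∃ C : ℝ, ∀ q ∈ Set.Ioo (0 : ℝ) 1, ‖f q‖ ≤ C * Real.sin (π * q) ^ (-1 / 4 : ℝ)

namespace MildEndpoints

lemma add {E : Type*} [NormedAddCommGroup E] {f g : ℝ → E} (hf : MildEndpoints f)
    (hg : MildEndpoints g) : MildEndpoints (fun q => f q + g q) := by
  obtain ⟨hf, C, hC⟩ := hf
  obtain ⟨hg, D, hD⟩ := hg
  refine ⟨hf.add hg, C + D, fun q hq => (norm_add_le _ _).trans ?_⟩
  rw [add_mul]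
  exact add_le_add (hC q hq) (hD q hq)

lemma sub {E : Type*} [NormedAddCommGroup E] {f g : ℝ → E} (hf : MildEndpoints f)
    (hg : MildEndpoints g) : MildEndpoints (fun q => f q - g q) := by
  obtain ⟨hf, C, hC⟩ := hf
  obtain ⟨hg, D, hD⟩ := hg
  refine ⟨hf.sub hg, C + D, fun q hq => (norm_sub_le _ _).trans ?_⟩
  rw [add_mul]
  exact add_le_add (hC q hq) (hD q hq)

lemma const_mul {f : ℝ → ℂ} (hf : MildEndpoints f) (a : ℂ) :
    MildEndpoints (fun q => a * f q) := by
  obtain ⟨hf, C, hC⟩ := hf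
  refine ⟨continuousOn_const.mul hf, ‖a‖ * C, fun q hq => ?_⟩
  rw [norm_mul, mul_assoc]
  exact mul_le_mul_of_nonneg_left (hC q hq) (norm_nonneg _)

lemma re {f : ℝ → ℂ} (hf : MildEndpoints f) : MildEndpoints (fun q => (f q).re) := by
  obtain ⟨hf, C, hC⟩ := hf
  exact ⟨Complex.continuous_re.comp_continuousOn hf, C,
    fun q hq => (Complex.abs_re_le_norm _).trans (hC q hq)⟩

lemma comp_one_sub {E : Type*} [NormedAddCommGroup E] {f : ℝ → E} (hf : MildEndpoints f) :
    MildEndpoints (fun q => f (1 - q)) := by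
  obtain ⟨hf, C, hC⟩ := hf
  have hm : ∀ q ∈ Set.Ioo (0 : ℝ) 1, 1 - q ∈ Set.Ioo (0 : ℝ) 1 := fun q hq =>
    ⟨by linarith [hq.2], by linarith [hq.1]⟩
  refine ⟨hf.comp (by fun_prop) hm, C, fun q hq => (hC _ (hm q hq)).trans_eq ?_⟩
  rw [mul_sub, mul_one, Real.sin_pi_sub]

lemma congr {E : Type*} [NormedAddCommGroup E] {f g : ℝ → E} (hf : MildEndpoints f)
    (h : Set.EqOn g f (Set.Ioo 0 1)) : MildEndpoints g := by
  obtain ⟨hf, C, hC⟩ := hf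
  exact ⟨hf.congr h, C, fun q hq => by rw [h hq]; exact hC q hq⟩

end MildEndpoints

lemma mildEndpoints_abelSeries {c : ℕ → ℂ} {M : ℝ}
    (hc : ∀ j, ‖c j‖ ≤ M * ((j : ℝ) + 1) ^ (-15 / 8 : ℝ)) :
    MildEndpoints (fun q => (1 - circleExp q)⁻¹ * abelSeries c q) := by
  constructor
  · refine ContinuousOn.mul (ContinuousOn.inv₀ ?_ fun q hq => one_sub_circleExp_ne_zero hq) ?_
    · exact (continuous_const.sub continuous_circleExp).continuousOn
    · refine (continuous_abelSeries ?_).continuousOn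
      exact Summable.of_nonneg_of_le (fun _ => norm_nonneg _) hc
        ((summable_add_one_rpow (by norm_num)).mul_left M)
  · refine ⟨∑' j, ‖c j‖ * ((j : ℝ) + 1) ^ (3 / 4 : ℝ), fun q hq => ?_⟩
    have hs := sin_pi_mul_pos hq
    have h := norm_abelSeries_le (summable_weighted hc) q
    rw [norm_mul, norm_inv, norm_one_sub_circleExp]
    rw [abs_of_pos hs] at h ⊢
    refine (mul_le_mul_of_nonneg_left h (by positivity)).trans_eq ?_
    rw [show (-1 / 4 : ℝ) = 3 / 4 - 1 by norm_num, Real.rpow_sub_one hs.ne']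
    field_simp

lemma mildEndpoints_expZeta {k : ℕ} (hk : 1 ≤ k) :
    MildEndpoints (fun q : ℝ => HurwitzZeta.expZeta q k) :=
  (mildEndpoints_abelSeries fun j =>
    norm_cpowIncr_le_of_le j (natCast_re_ge hk) le_rfl).congr
    fun _ hq => expZeta_eq_abelSeries hq hk

lemma mildEndpoints_deriv_expZeta {k : ℕ} (hk : 1 ≤ k) :
    MildEndpoints (fun q : ℝ => deriv (HurwitzZeta.expZeta q) k) :=
  (mildEndpoints_abelSeries fun j => norm_deriv_cpowIncr_le j hk).congr
    fun _ hq => deriv_expZeta_eq_abelSeries hq hk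

lemma coe_one_sub (q : ℝ) : ((1 - q : ℝ) : UnitAddCircle) = -(q : UnitAddCircle) := by
  have h : ((1 : ℝ) : UnitAddCircle) = 0 := AddCircle.coe_period 1
  rw [AddCircle.coe_sub, h, zero_sub]

lemma natCast_ne_neg {k : ℕ} (hk : 1 ≤ k) (n : ℕ) : (k : ℂ) ≠ -n := by
  intro h
  have : ((k + n : ℕ) : ℂ) = 0 := by push_cast; rw [h]; ring
  have := Nat.cast_eq_zero.1 this
  omega

lemma eventually_ne_neg_natCast {k : ℕ} (hk : 1 ≤ k) :
    ∀ᶠ s in nhds (k : ℂ), ∀ n : ℕ, s ≠ -(n : ℂ) := by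
  have : {s : ℂ | 0 < s.re} ∈ nhds (k : ℂ) :=
    (isOpen_lt continuous_const Complex.continuous_re).mem_nhds (by simpa using Nat.pos_of_ne_zero (by omega))
  filter_upwards [this] with s hs n h
  rw [h] at hs
  have : (0 : ℝ) ≤ n := n.cast_nonneg
  simp at hs
  linarith

/-- The derivative of a function at `1 - k`, read off after the reflection `s ↦ 1 - s`. -/
lemma deriv_one_sub_eq {f g : ℂ → ℂ} {g' : ℂ} {k : ℂ}
    (h : (fun s => f (1 - s)) =ᶠ[nhds k] g) (hg : HasDerivAt g g' k) : deriv f (1 - k) = -g' := by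
  have h1 := hg.congr_of_eventuallyEq h
  have h2 : HasDerivAt (fun s : ℂ => 1 - s) (-1) (1 - k) := by
    simpa using (hasDerivAt_id (1 - k)).const_sub 1
  have h3 : HasDerivAt (fun s => f (1 - s)) g' (1 - (1 - k)) := by simpa using h1
  have h4 := h3.comp (1 - k) h2
  have h5 : ((fun s => f (1 - s)) ∘ fun s => 1 - s) = f := by
    ext s
    simp
  rw [h5] at h4
  rw [h4.deriv]
  ring

lemma two_pi_ne_zero_complex : (2 * π : ℂ) ≠ 0 := by
  exact_mod_cast Real.two_pi_pos.ne'

lemma differentiableAt_two_pi_cpow_mul_Gamma {k : ℕ} (hk : 1 ≤ k) :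
    DifferentiableAt ℂ (fun s : ℂ => (2 * π : ℂ) ^ (-s) * Complex.Gamma s) k :=
  (differentiableAt_id.neg.const_cpow (Or.inl two_pi_ne_zero_complex)).mul
    (Complex.differentiableAt_Gamma _ (natCast_ne_neg hk))

lemma mildEndpoints_A {k : ℕ} (hk : 1 ≤ k) : MildEndpoints (A k) := by
  set P : ℂ → ℂ := fun s => (2 * π : ℂ) ^ (-s) * Complex.Gamma s *
    Complex.exp (-π * Complex.I * s / 2) with hP
  set R : ℂ → ℂ := fun s => (2 * π : ℂ) ^ (-s) * Complex.Gamma s *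
    Complex.exp (π * Complex.I * s / 2) with hR
  have hdP : DifferentiableAt ℂ P k :=
    (differentiableAt_two_pi_cpow_mul_Gamma hk).mul (by fun_prop)
  have hdR : DifferentiableAt ℂ R k :=
    (differentiableAt_two_pi_cpow_mul_Gamma hk).mul (by fun_prop)
  have hF := mildEndpoints_expZeta hk
  have hF' := mildEndpoints_deriv_expZeta hk
  have key := ((((hF.const_mul (deriv P k)).add (hF'.const_mul (P k))).add
    ((hF.comp_one_sub.const_mul (deriv R k)).add
      (hF'.comp_one_sub.const_mul (R k)))).const_mul (-k)).re
  refine key.congr fun q hq => ?_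
  have hq0 := coe_unitAddCircle_ne_zero hq
  have hF1 := (HurwitzZeta.differentiable_expZeta_of_ne_zero hq0 k).hasDerivAt
  have hF2 := (HurwitzZeta.differentiable_expZeta_of_ne_zero (neg_ne_zero.2 hq0) k).hasDerivAt
  have h1 := (hdP.hasDerivAt.mul hF1).add (hdR.hasDerivAt.mul hF2)
  have h2 : (fun s => HurwitzZeta.hurwitzZeta (q : UnitAddCircle) (1 - s)) =ᶠ[nhds (k : ℂ)]
      P * HurwitzZeta.expZeta q + R * HurwitzZeta.expZeta (-q) := by
    filter_upwards [eventually_ne_neg_natCast hk] with s hs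
    rw [HurwitzZeta.hurwitzZeta_one_sub _ hs (Or.inl hq0)]
    simp only [Pi.add_apply, Pi.mul_apply, hP, hR]
    ring
  have h3 := deriv_one_sub_eq h2 h1
  change (k : ℝ) * (deriv (HurwitzZeta.hurwitzZeta (q : UnitAddCircle)) (1 - (k : ℂ))).re = _
  simp only [coe_one_sub]
  rw [h3, ← Complex.re_ofReal_mul]
  congr 1
  push_cast
  ring

lemma mildEndpoints_K : MildEndpoints K := by
  constructor
  · refine ContinuousOn.log (by fun_prop) fun q hq => (sin_pi_mul_pos hq).ne'
  · refine ⟨4, fun q hq => ?_⟩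
    have hs := sin_pi_mul_pos hq
    have h := Real.abs_log_mul_self_rpow_lt _ (1 / 4) hs (Real.sin_le_one _) (by norm_num)
    rw [abs_mul, abs_of_pos (Real.rpow_pos_of_pos hs _)] at h
    rw [show (-1 / 4 : ℝ) = -(1 / 4) by norm_num, Real.rpow_neg hs.le, ← div_eq_mul_inv,
      le_div_iff₀ (Real.rpow_pos_of_pos hs _)]
    norm_num at h ⊢
    exact h.le

lemma two_mul_le_sin_pi_mul {q : ℝ} (h0 : 0 ≤ q) (h1 : q ≤ 1 / 2) : 2 * q ≤ Real.sin (π * q) := by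
  have h := Real.mul_le_sin (x := π * q) (by positivity) (by nlinarith [Real.pi_pos])
  rwa [← mul_assoc, div_mul_cancel₀ _ Real.pi_pos.ne'] at h

lemma sin_rpow_le {q : ℝ} (hq : q ∈ Set.Ioo (0 : ℝ) 1) :
    Real.sin (π * q) ^ (-3 / 4 : ℝ) ≤ q ^ (-3 / 4 : ℝ) + (1 - q) ^ (-3 / 4 : ℝ) := by
  have hq0 := hq.1
  have hq1 : 0 < 1 - q := by linarith [hq.2]
  have h0 := Real.rpow_pos_of_pos hq0 (-3 / 4)
  have h1 := Real.rpow_pos_of_pos hq1 (-3 / 4)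
  rcases le_total q (1 / 2) with h | h
  · have := two_mul_le_sin_pi_mul hq0.le h
    have := Real.rpow_le_rpow_of_nonpos hq0 (by linarith : q ≤ Real.sin (π * q))
      (by norm_num : (-3 / 4 : ℝ) ≤ 0)
    linarith
  · have := two_mul_le_sin_pi_mul hq1.le (by linarith)
    rw [show π * (1 - q) = π - π * q by ring, Real.sin_pi_sub] at this
    have := Real.rpow_le_rpow_of_nonpos hq1 (by linarith : 1 - q ≤ Real.sin (π * q))
      (by norm_num : (-3 / 4 : ℝ) ≤ 0)
    linarith

lemma intervalIntegrable_of_le_sin_rpow {f : ℝ → ℝ} (hf : ContinuousOn f (Set.Ioo 0 1)) {C : ℝ}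
    (hC : ∀ q ∈ Set.Ioo (0 : ℝ) 1, |f q| ≤ C * Real.sin (π * q) ^ (-3 / 4 : ℝ)) :
    IntervalIntegrable f volume 0 1 := by
  have hi1 : IntervalIntegrable (fun q : ℝ => q ^ (-3 / 4 : ℝ)) volume 0 1 :=
    intervalIntegral.intervalIntegrable_rpow' (by norm_num)
  have hi2 : IntervalIntegrable (fun q : ℝ => (1 - q) ^ (-3 / 4 : ℝ)) volume 0 1 := by
    simpa using (hi1.comp_sub_left 1).symm
  have hi := (hi1.add hi2).const_mul |C|
  rw [intervalIntegrable_iff_integrableOn_Ioo_of_le zero_le_one] at hi ⊢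
  refine Integrable.mono' hi (hf.aestronglyMeasurable measurableSet_Ioo) ?_
  filter_upwards [ae_restrict_mem measurableSet_Ioo] with q hq
  have hs := sin_pi_mul_pos hq
  calc ‖f q‖ ≤ C * Real.sin (π * q) ^ (-3 / 4 : ℝ) := hC q hq
    _ ≤ |C| * Real.sin (π * q) ^ (-3 / 4 : ℝ) := by
      gcongr
      exact le_abs_self C
    _ ≤ _ := mul_le_mul_of_nonneg_left (sin_rpow_le hq) (abs_nonneg _)

lemma MildEndpoints.intervalIntegrable_mul_mul {f g h : ℝ → ℝ} (hf : MildEndpoints f)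
    (hg : MildEndpoints g) (hh : MildEndpoints h) :
    IntervalIntegrable (fun q => f q * g q * h q) volume 0 1 := by
  obtain ⟨hf, C, hC⟩ := hf
  obtain ⟨hg, D, hD⟩ := hg
  obtain ⟨hh, E, hE⟩ := hh
  refine intervalIntegrable_of_le_sin_rpow ((hf.mul hg).mul hh) (C := C * D * E) fun q hq => ?_
  have hs := sin_pi_mul_pos hq
  have h1 := hC q hq
  have h2 := hD q hq
  have h3 := hE q hq
  have h4 := (norm_nonneg _).trans h1
  have h5 := (norm_nonneg _).trans h2
  rw [abs_mul, abs_mul]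
  refine (mul_le_mul (mul_le_mul h1 h2 (norm_nonneg _) h4) h3 (norm_nonneg _)
    (mul_nonneg h4 h5)).trans_eq ?_
  rw [show (-3 / 4 : ℝ) = -1 / 4 + -1 / 4 + -1 / 4 by norm_num, Real.rpow_add hs, Real.rpow_add hs]
  ring

lemma add_two_mul_cpowIncr (j k : ℕ) :
    ((j : ℂ) + 2) * cpowIncr j (k + 1 : ℕ) =
      cpowIncr j k + ((j : ℂ) + 1) ^ (-((k + 1 : ℕ) : ℂ)) := by
  have h1 : ((j : ℂ) + 1) ≠ 0 := by exact_mod_cast Nat.succ_ne_zero j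
  have h2 : ((j : ℂ) + 2) ≠ 0 := by exact_mod_cast Nat.succ_ne_zero (j + 1)
  simp only [cpowIncr, Complex.cpow_neg, Complex.cpow_natCast]
  field_simp
  ring

lemma hasDerivAt_circleExp_pow (q : ℝ) (n : ℕ) :
    HasDerivAt (fun x => circleExp x ^ n) (2 * π * Complex.I * n * circleExp q ^ n) q := by
  have h : HasDerivAt (fun x : ℝ => Complex.exp ((2 * π * Complex.I * n) * (x : ℂ)))
      (Complex.exp ((2 * π * Complex.I * n) * (q : ℂ)) * ((2 * π * Complex.I * n) * 1)) q := by
    exact ((Complex.ofRealCLM.hasDerivAt (x := q)).const_mul _).cexp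
  have he : ∀ x : ℝ, circleExp x ^ n = Complex.exp ((2 * π * Complex.I * n) * (x : ℂ)) := by
    intro x
    rw [circleExp, ← Complex.exp_nat_mul]
    ring_nf
  simp_rw [he]
  convert! h using 1
  ring

lemma hasSum_expZeta_natCast_succ (q : ℝ) {k : ℕ} (hk : 1 ≤ k) :
    HasSum (fun j : ℕ => circleExp q ^ (j + 1) * ((j : ℂ) + 1) ^ (-((k + 1 : ℕ) : ℂ)))
      (HurwitzZeta.expZeta q (k + 1 : ℕ)) := by
  have h0 := HurwitzZeta.hasSum_expZeta_of_one_lt_re q (s := (k + 1 : ℕ)) (by simpa using Nat.pos_of_ne_zero (by omega))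
  have h1 := (hasSum_nat_add_iff' 1).2 h0
  convert! h1 using 1
  · ext j
    rw [circleExp, ← Complex.exp_nat_mul, Complex.cpow_neg, div_eq_mul_inv]
    push_cast
    ring_nf
  · have h0 : ((k + 1 : ℕ) : ℂ) ≠ 0 := by exact_mod_cast Nat.succ_ne_zero k
    rw [Finset.sum_range_one, Nat.cast_zero, Complex.zero_cpow h0, div_zero, sub_zero]

lemma hasDerivAt_abelSeries (q : ℝ) {k : ℕ} (hk : 1 ≤ k) :
    HasDerivAt (abelSeries fun j => cpowIncr j (k + 1 : ℕ))
      (2 * π * Complex.I * (abelSeries (fun j => cpowIncr j k) q -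
        circleExp q * HurwitzZeta.expZeta q (k + 1 : ℕ))) q := by
  set g' : ℕ → ℝ → ℂ := fun j x => (2 * π * Complex.I * (1 : ℕ) * circleExp x ^ 1 -
    2 * π * Complex.I * (j + 2 : ℕ) * circleExp x ^ (j + 2)) * cpowIncr j (k + 1 : ℕ) with hg'
  have hb1 : ∀ j, ‖cpowIncr j (k + 1 : ℕ)‖ ≤ ‖((k + 1 : ℕ) : ℂ)‖ *
      ((j : ℝ) + 1) ^ (-15 / 8 : ℝ) := fun j =>
    norm_cpowIncr_le_of_le j (natCast_re_ge (by omega)) le_rfl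
  have hb0 : ∀ j, ‖cpowIncr j k‖ ≤ ‖(k : ℂ)‖ * ((j : ℝ) + 1) ^ (-15 / 8 : ℝ) := fun j =>
    norm_cpowIncr_le_of_le j (natCast_re_ge hk) le_rfl
  have hs : Summable fun j : ℕ => ((j : ℝ) + 1) ^ (-15 / 8 : ℝ) :=
    summable_add_one_rpow (by norm_num)
  have hform : ∀ j x, g' j x = 2 * π * Complex.I *
      (circleExp x * cpowIncr j (k + 1 : ℕ) - (circleExp x ^ (j + 2) * cpowIncr j k +
        circleExp x * (circleExp x ^ (j + 1) * ((j : ℂ) + 1) ^ (-((k + 1 : ℕ) : ℂ))))) := by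
    intro j x
    have h := add_two_mul_cpowIncr j k
    have : g' j x = 2 * π * Complex.I * (circleExp x * cpowIncr j (k + 1 : ℕ) -
        circleExp x ^ (j + 2) * (((j : ℂ) + 2) * cpowIncr j (k + 1 : ℕ))) := by
      simp only [hg']
      push_cast
      ring
    rw [this, h]
    ring
  have hpow : ∀ j : ℕ, ‖((j : ℂ) + 1) ^ (-((k + 1 : ℕ) : ℂ))‖ ≤ ((j : ℝ) + 1) ^ (-15 / 8 : ℝ) := by
    intro j
    have : ((j : ℂ) + 1) = (((j : ℝ) + 1 : ℝ) : ℂ) := by push_cast; ring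
    rw [this, Complex.norm_cpow_eq_rpow_re_of_pos (by positivity)]
    have hk' : (1 : ℝ) ≤ k := by exact_mod_cast hk
    apply Real.rpow_le_rpow_of_exponent_le
    · linarith [j.cast_nonneg (α := ℝ)]
    · simp
      linarith
  have hbound : ∀ j x, ‖g' j x‖ ≤ 2 * π * ((‖((k + 1 : ℕ) : ℂ)‖ * ((j : ℝ) + 1) ^ (-15 / 8 : ℝ)) +
      ((‖(k : ℂ)‖ * ((j : ℝ) + 1) ^ (-15 / 8 : ℝ)) + ((j : ℝ) + 1) ^ (-15 / 8 : ℝ))) := by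
    intro j x
    rw [hform, norm_mul]
    have : ‖(2 * π * Complex.I : ℂ)‖ = 2 * π := by
      simp [abs_of_pos Real.pi_pos]
    rw [this]
    gcongr
    refine (norm_sub_le _ _).trans (add_le_add ?_ ((norm_add_le _ _).trans (add_le_add ?_ ?_)))
    · rw [norm_mul, norm_circleExp, one_mul]
      exact hb1 j
    · rw [norm_mul, norm_pow, norm_circleExp, one_pow, one_mul]
      exact hb0 j
    · rw [norm_mul, norm_mul, norm_pow, norm_circleExp, one_pow, one_mul, one_mul]
      exact hpow j
  have hderiv := hasDerivAt_tsum
    (g := fun j x => (circleExp x - circleExp x ^ (j + 2)) * cpowIncr j (k + 1 : ℕ)) (g' := g')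
    (((hs.mul_left _).add ((hs.mul_left _).add hs)).mul_left (2 * π))
    (fun j x => by
      have h1 := hasDerivAt_circleExp_pow x 1
      have h2 := (h1.sub (hasDerivAt_circleExp_pow x (j + 2))).mul_const (cpowIncr j (k + 1 : ℕ))
      simpa [hg'] using h2)
    hbound (y₀ := 0)
    (Summable.of_norm_bounded ((hs.mul_left ‖((k + 1 : ℕ) : ℂ)‖).mul_left 2) fun j =>
      (norm_abel_term_le _ _ _).trans (by gcongr; exact hb1 j)) q
  have e1 := (hasSum_cpowIncr (natCast_re_ge (show 1 ≤ k + 1 by omega))).mul_left (circleExp q)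
  have e0 := (hasSum_cpowIncr (natCast_re_ge hk)).mul_left (circleExp q)
  have eA : HasSum (fun j => (circleExp q - circleExp q ^ (j + 2)) * cpowIncr j k)
      (abelSeries (fun j => cpowIncr j k) q) :=
    (Summable.of_norm_bounded ((hs.mul_left ‖(k : ℂ)‖).mul_left 2) fun j =>
      (norm_abel_term_le _ _ _).trans (by gcongr; exact hb0 j)).hasSum
  have eF := (hasSum_expZeta_natCast_succ q hk).mul_left (circleExp q)
  have etot := (((e1.sub e0).add (eA.sub eF)).mul_left (2 * π * Complex.I))
  have : (2 * π * Complex.I * (abelSeries (fun j => cpowIncr j k) q -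
        circleExp q * HurwitzZeta.expZeta q (k + 1 : ℕ))) = ∑' j, g' j q := by
    have h2 : (fun j => g' j q) = fun j => 2 * π * Complex.I *
        (circleExp q * cpowIncr j (k + 1 : ℕ) - circleExp q * cpowIncr j k +
        ((circleExp q - circleExp q ^ (j + 2)) * cpowIncr j k -
        circleExp q * (circleExp q ^ (j + 1) * ((j : ℂ) + 1) ^ (-((k + 1 : ℕ) : ℂ))))) := by
      ext j
      rw [hform]
      ring
    rw [h2, etot.tsum_eq]
    ring
  rw [this]
  exact hderiv

lemma hasDerivAt_expZeta {q : ℝ} (hq : q ∈ Set.Ioo (0 : ℝ) 1) {k : ℕ} (hk : 1 ≤ k) :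
    HasDerivAt (fun x : ℝ => HurwitzZeta.expZeta x (k + 1 : ℕ))
      (2 * π * Complex.I * HurwitzZeta.expZeta q k) q := by
  have hz := one_sub_circleExp_ne_zero hq
  have h1 := (hasDerivAt_circleExp_pow q 1).const_sub 1
  simp only [pow_one] at h1
  have h2 := (h1.inv hz).mul (hasDerivAt_abelSeries q hk)
  have h3 : (fun x : ℝ => HurwitzZeta.expZeta x (k + 1 : ℕ)) =ᶠ[nhds q]
      (fun x => (1 - circleExp x)⁻¹) * (abelSeries fun j => cpowIncr j (k + 1 : ℕ)) := by
    filter_upwards [isOpen_Ioo.mem_nhds hq] with x hx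
    exact expZeta_eq_abelSeries hx (by omega)
  refine (h2.congr_of_eventuallyEq h3).congr_deriv ?_
  rw [expZeta_eq_abelSeries hq hk, expZeta_eq_abelSeries hq (show 1 ≤ k + 1 by omega)]
  simp only [Pi.inv_apply]
  field_simp
  push_cast
  ring

/-- The cosine Clausen-type function `∑ cos (2 * π * n * q) / n ^ k`. -/
noncomputable def cosPoly (k : ℕ) (q : ℝ) : ℝ := (HurwitzZeta.cosZeta q k).re

/-- The sine Clausen-type function `∑ sin (2 * π * n * q) / n ^ k`. -/
noncomputable def sinPoly (k : ℕ) (q : ℝ) : ℝ := (HurwitzZeta.sinZeta q k).re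

lemma one_sub_mem_Ioo {q : ℝ} (hq : q ∈ Set.Ioo (0 : ℝ) 1) : 1 - q ∈ Set.Ioo (0 : ℝ) 1 :=
  ⟨by linarith [hq.2], by linarith [hq.1]⟩

lemma hasDerivAt_expZeta_neg {q : ℝ} (hq : q ∈ Set.Ioo (0 : ℝ) 1) {k : ℕ} (hk : 1 ≤ k) :
    HasDerivAt (fun x : ℝ => HurwitzZeta.expZeta (-(x : UnitAddCircle)) (k + 1 : ℕ))
      (-(2 * π * Complex.I * HurwitzZeta.expZeta (-(q : UnitAddCircle)) k)) q := by
  have h := (hasDerivAt_expZeta (one_sub_mem_Ioo hq) hk).scomp q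
    ((hasDerivAt_id q).const_sub 1)
  simp only [Function.comp_def, coe_one_sub] at h
  simpa using h

lemma hasDerivAt_cosPoly {q : ℝ} (hq : q ∈ Set.Ioo (0 : ℝ) 1) {k : ℕ} (hk : 1 ≤ k) :
    HasDerivAt (cosPoly (k + 1)) (-(2 * π) * sinPoly k q) q := by
  have h := ((hasDerivAt_expZeta hq hk).add (hasDerivAt_expZeta_neg hq hk)).div_const 2
  have h1 := Complex.reCLM.hasFDerivAt.comp_hasDerivAt q h
  refine (h1.congr_of_eventuallyEq (Filter.Eventually.of_forall fun x => ?_)).congr_deriv ?_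
  · simp only [cosPoly, HurwitzZeta.cosZeta_eq]
    rfl
  · simp only [sinPoly]
    rw [← neg_mul, ← Complex.re_ofReal_mul, HurwitzZeta.sinZeta_eq]
    change Complex.re _ = _
    congr 1
    push_cast
    field_simp
    rw [Complex.I_sq]
    ring

lemma hasDerivAt_sinPoly {q : ℝ} (hq : q ∈ Set.Ioo (0 : ℝ) 1) {k : ℕ} (hk : 1 ≤ k) :
    HasDerivAt (sinPoly (k + 1)) (2 * π * cosPoly k q) q := by
  have h := ((hasDerivAt_expZeta hq hk).sub (hasDerivAt_expZeta_neg hq hk)).div_const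
    (2 * Complex.I)
  have h1 := Complex.reCLM.hasFDerivAt.comp_hasDerivAt q h
  refine (h1.congr_of_eventuallyEq (Filter.Eventually.of_forall fun x => ?_)).congr_deriv ?_
  · simp only [sinPoly, HurwitzZeta.sinZeta_eq]
    rfl
  · simp only [cosPoly]
    rw [← Complex.ofReal_ofNat, ← Complex.ofReal_mul, ← Complex.re_ofReal_mul, HurwitzZeta.cosZeta_eq]
    change Complex.re _ = _
    congr 1
    push_cast
    field_simp
    ring

lemma mildEndpoints_cosPoly {k : ℕ} (hk : 1 ≤ k) : MildEndpoints (cosPoly k) := by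
  have h := mildEndpoints_expZeta hk
  refine ((h.add h.comp_one_sub).const_mul (1 / 2)).re.congr fun q hq => ?_
  simp only [cosPoly, HurwitzZeta.cosZeta_eq, coe_one_sub]
  congr 1
  ring

lemma mildEndpoints_sinPoly {k : ℕ} (hk : 1 ≤ k) : MildEndpoints (sinPoly k) := by
  have h := mildEndpoints_expZeta hk
  refine ((h.add (h.comp_one_sub.const_mul (-1))).const_mul (1 / (2 * Complex.I))).re.congr
    fun q hq => ?_
  simp only [sinPoly, HurwitzZeta.sinZeta_eq, coe_one_sub]
  congr 1
  ring

lemma differentiableAt_hurwitzZeta_one_sub (a : UnitAddCircle) {k : ℕ} (hk : 1 ≤ k) :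
    DifferentiableAt ℂ (HurwitzZeta.hurwitzZeta a) (1 - k) :=
  HurwitzZeta.differentiableAt_hurwitzZeta a (by
    have : (k : ℂ) ≠ 0 := by exact_mod_cast (by omega : k ≠ 0)
    simpa using this)

lemma A_eq (k : ℕ) (q : ℝ) :
    A k q = (k * deriv (HurwitzZeta.hurwitzZeta (q : UnitAddCircle)) (1 - (k : ℂ))).re := by
  rw [← Complex.ofReal_natCast k, Complex.re_ofReal_mul]
  rfl

lemma Gamma_natCast_mul {k : ℕ} (hk : 1 ≤ k) : (k : ℂ) * Complex.Gamma k = k.factorial := by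
  have hk0 : (k : ℂ) ≠ 0 := by exact_mod_cast (by omega : k ≠ 0)
  rw [← Complex.Gamma_add_one _ hk0, Complex.Gamma_nat_eq_factorial]

lemma two_pi_cpow_neg_natCast (k : ℕ) :
    (2 * π : ℂ) ^ (-(k : ℂ)) = (((2 * π) ^ k : ℝ) : ℂ)⁻¹ := by
  rw [Complex.cpow_neg, Complex.cpow_natCast]
  push_cast
  rfl

lemma A_add_A_one_sub {q : ℝ} (hq : q ∈ Set.Ioo (0 : ℝ) 1) (i : ℕ) :
    A (2 * i + 1) q + A (2 * i + 1) (1 - q) =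
      (-1) ^ i * (2 * π * (2 * i + 1).factorial / (2 * π) ^ (2 * i + 1)) *
        cosPoly (2 * i + 1) q := by
  set k := 2 * i + 1 with hkdef
  have hk : 1 ≤ k := by omega
  have hq0 := coe_unitAddCircle_ne_zero hq
  have hd1 := (differentiableAt_hurwitzZeta_one_sub (q : UnitAddCircle) hk).hasDerivAt
  have hd2 := (differentiableAt_hurwitzZeta_one_sub (-(q : UnitAddCircle)) hk).hasDerivAt
  have hE : HurwitzZeta.hurwitzZetaEven (q : UnitAddCircle) =
      fun s => (HurwitzZeta.hurwitzZeta q s + HurwitzZeta.hurwitzZeta (-q) s) / 2 :=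
    funext fun s => HurwitzZeta.hurwitzZetaEven_eq _ s
  have hdE := ((hd1.add hd2).div_const 2).deriv
  have harg : (π * (k : ℂ) / 2) = i * π + π / 2 := by
    rw [hkdef]
    push_cast
    ring
  have hcos : Complex.cos (π * k / 2) = 0 := by
    rw [harg, Complex.cos_add_pi_div_two, Complex.sin_nat_mul_pi, neg_zero]
  have hsin : Complex.sin (π * k / 2) = (-1) ^ i := by
    rw [harg, Complex.sin_add_pi_div_two, ← Complex.ofReal_natCast, ← Complex.ofReal_mul, ← Complex.ofReal_cos,
      Real.cos_nat_mul_pi]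
    push_cast
    rfl
  have hc : HasDerivAt (fun s : ℂ => Complex.cos (π * s / 2))
      (-Complex.sin (π * k / 2) * (π * 1 / 2)) (k : ℂ) :=
    (((hasDerivAt_id (k : ℂ)).const_mul (π : ℂ)).div_const 2).ccos
  have hP := (differentiableAt_two_pi_cpow_mul_Gamma hk).hasDerivAt
  have hF := (HurwitzZeta.differentiable_cosZeta_of_ne_zero hq0 k).hasDerivAt
  have hprod := (hP.const_mul 2).mul (hc.mul hF)
  have hder := deriv_one_sub_eq (f := HurwitzZeta.hurwitzZetaEven (q : UnitAddCircle)) (by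
    filter_upwards [eventually_ne_neg_natCast hk] with s hs
    rw [HurwitzZeta.hurwitzZetaEven_one_sub _ hs (Or.inl hq0)]
    simp only [Pi.mul_apply]
    ring) hprod
  rw [A_eq, A_eq, coe_one_sub, ← Complex.add_re, ← mul_add]
  have hsum : deriv (HurwitzZeta.hurwitzZeta (q : UnitAddCircle)) (1 - k) +
      deriv (HurwitzZeta.hurwitzZeta (-(q : UnitAddCircle))) (1 - k) =
      2 * deriv (HurwitzZeta.hurwitzZetaEven (q : UnitAddCircle)) (1 - k) := by
    rw [hE]
    refine Eq.trans ?_ (congrArg (2 * ·) hdE.symm)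
    ring
  rw [hsum, hder, cosPoly, ← Complex.re_ofReal_mul]
  congr 1
  simp only [Pi.mul_apply]
  rw [hcos, hsin, two_pi_cpow_neg_natCast]
  have hG := Gamma_natCast_mul hk
  push_cast
  rw [← hG]
  ring

lemma A_sub_A_one_sub (q : ℝ) {i : ℕ} (hi : 1 ≤ i) :
    A (2 * i) q - A (2 * i) (1 - q) =
      -((-1) ^ i * (2 * π * (2 * i).factorial / (2 * π) ^ (2 * i)) * sinPoly (2 * i) q) := by
  set k := 2 * i with hkdef
  have hk : 1 ≤ k := by omega
  have hd1 := (differentiableAt_hurwitzZeta_one_sub (q : UnitAddCircle) hk).hasDerivAt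
  have hd2 := (differentiableAt_hurwitzZeta_one_sub (-(q : UnitAddCircle)) hk).hasDerivAt
  have hE : HurwitzZeta.hurwitzZetaOdd (q : UnitAddCircle) =
      fun s => (HurwitzZeta.hurwitzZeta q s - HurwitzZeta.hurwitzZeta (-q) s) / 2 :=
    funext fun s => HurwitzZeta.hurwitzZetaOdd_eq _ s
  have hdE := ((hd1.sub hd2).div_const 2).deriv
  have harg : (π * (k : ℂ) / 2) = i * π := by
    rw [hkdef]
    push_cast
    ring
  have hsin : Complex.sin (π * k / 2) = 0 := by
    rw [harg, Complex.sin_nat_mul_pi]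
  have hcos : Complex.cos (π * k / 2) = (-1) ^ i := by
    rw [harg, ← Complex.ofReal_natCast, ← Complex.ofReal_mul, ← Complex.ofReal_cos,
      Real.cos_nat_mul_pi]
    push_cast
    rfl
  have hc : HasDerivAt (fun s : ℂ => Complex.sin (π * s / 2))
      (Complex.cos (π * k / 2) * (π * 1 / 2)) (k : ℂ) :=
    (((hasDerivAt_id (k : ℂ)).const_mul (π : ℂ)).div_const 2).csin
  have hP := (differentiableAt_two_pi_cpow_mul_Gamma hk).hasDerivAt
  have hF := (HurwitzZeta.differentiableAt_sinZeta (q : UnitAddCircle) k).hasDerivAt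
  have hprod := (hP.const_mul 2).mul (hc.mul hF)
  have hder := deriv_one_sub_eq (f := HurwitzZeta.hurwitzZetaOdd (q : UnitAddCircle)) (by
    filter_upwards [eventually_ne_neg_natCast hk] with s hs
    rw [HurwitzZeta.hurwitzZetaOdd_one_sub _ hs]
    simp only [Pi.mul_apply]
    ring) hprod
  rw [A_eq, A_eq, coe_one_sub, ← Complex.sub_re, ← mul_sub]
  have hsum : deriv (HurwitzZeta.hurwitzZeta (q : UnitAddCircle)) (1 - k) -
      deriv (HurwitzZeta.hurwitzZeta (-(q : UnitAddCircle))) (1 - k) =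
      2 * deriv (HurwitzZeta.hurwitzZetaOdd (q : UnitAddCircle)) (1 - k) := by
    rw [hE]
    refine Eq.trans ?_ (congrArg (2 * ·) hdE.symm)
    ring
  rw [hsum, hder, sinPoly, ← Complex.re_ofReal_mul, ← Complex.neg_re]
  congr 1
  simp only [Pi.mul_apply]
  rw [hcos, hsin, two_pi_cpow_neg_natCast]
  have hG := Gamma_natCast_mul hk
  push_cast
  rw [← hG]
  ring

lemma hasSum_sinPoly {k : ℕ} (hk : 2 ≤ k) (q : ℝ) :
    HasSum (fun r : ℕ => Real.sin (2 * π * q * r) / (r : ℝ) ^ k) (sinPoly k q) := by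
  have hk' : (2 : ℝ) ≤ k := by exact_mod_cast hk
  have h := Complex.hasSum_re
    (HurwitzZeta.hasSum_nat_sinZeta q (s := (k : ℂ)) (by simp; linarith))
  refine h.congr_fun fun r => ?_
  rw [Complex.cpow_natCast]
  norm_cast

lemma hasSum_cosPoly {k : ℕ} (hk : 2 ≤ k) (q : ℝ) :
    HasSum (fun r : ℕ => Real.cos (2 * π * q * r) / (r : ℝ) ^ k) (cosPoly k q) := by
  have hk' : (2 : ℝ) ≤ k := by exact_mod_cast hk
  have h := Complex.hasSum_re
    (HurwitzZeta.hasSum_nat_cosZeta q (s := (k : ℂ)) (by simp; linarith))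
  refine h.congr_fun fun r => ?_
  rw [Complex.cpow_natCast]
  norm_cast

lemma abs_sin_two_pi_mul_le (q : ℝ) (r : ℕ) :
    |Real.sin (2 * π * q * r)| ≤ 2 * (r : ℝ) ^ (3 / 4 : ℝ) * |Real.sin (π * q)| ^ (3 / 4 : ℝ) := by
  have h := abs_sin_natCast_mul_le_rpow (2 * r) (π * q)
  rw [show ((2 * r : ℕ) : ℝ) * (π * q) = 2 * π * q * r by push_cast; ring] at h
  refine h.trans ?_
  gcongr
  push_cast
  rw [Real.mul_rpow (by norm_num) (by positivity)]
  gcongr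
  calc (2 : ℝ) ^ (3 / 4 : ℝ) ≤ 2 ^ (1 : ℝ) :=
        Real.rpow_le_rpow_of_exponent_le (by norm_num) (by norm_num)
    _ = 2 := by norm_num

lemma summable_rpow_div_pow {k : ℕ} (hk : 2 ≤ k) :
    Summable fun r : ℕ => 2 * (r : ℝ) ^ (3 / 4 : ℝ) / (r : ℝ) ^ k := by
  have h : Summable fun r : ℕ => 2 * (r : ℝ) ^ (-5 / 4 : ℝ) :=
    (Real.summable_nat_rpow.2 (by norm_num)).mul_left 2
  refine h.of_nonneg_of_le (fun r => by positivity) fun r => ?_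
  rcases Nat.eq_zero_or_pos r with rfl | hr
  · simp [show k ≠ 0 by omega]
  · have hr0 : (0 : ℝ) < r := by exact_mod_cast hr
    have hr1 : (1 : ℝ) ≤ r := by exact_mod_cast hr
    rw [div_le_iff₀ (by positivity), mul_assoc]
    gcongr
    calc (r : ℝ) ^ (3 / 4 : ℝ) = (r : ℝ) ^ (-5 / 4 : ℝ) * (r : ℝ) ^ 2 := by
          rw [← Real.rpow_natCast, ← Real.rpow_add hr0]
          norm_num
      _ ≤ _ := by
          gcongr

lemma abs_sinPoly_le {k : ℕ} (hk : 2 ≤ k) : ∃ C : ℝ, ∀ q ∈ Set.Ioo (0 : ℝ) 1,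
    |sinPoly k q| ≤ C * Real.sin (π * q) ^ (3 / 4 : ℝ) := by
  refine ⟨∑' r : ℕ, 2 * (r : ℝ) ^ (3 / 4 : ℝ) / (r : ℝ) ^ k, fun q hq => ?_⟩
  have hs := sin_pi_mul_pos hq
  have h := (summable_rpow_div_pow hk).hasSum.mul_right (Real.sin (π * q) ^ (3 / 4 : ℝ))
  rw [← (hasSum_sinPoly hk q).tsum_eq, ← Real.norm_eq_abs]
  refine tsum_of_norm_bounded h fun r => ?_
  have hr := abs_sin_two_pi_mul_le q r
  rw [abs_of_pos hs] at hr
  rw [norm_div, norm_pow, Real.norm_natCast, Real.norm_eq_abs, div_mul_eq_mul_div]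
  gcongr

/-- The function `cot (πq)`. -/
noncomputable def cotPi (q : ℝ) : ℝ := Real.cos (π * q) / Real.sin (π * q)

lemma continuousOn_cotPi : ContinuousOn cotPi (Set.Ioo 0 1) :=
  ContinuousOn.div (by fun_prop) (by fun_prop) fun _ hq => (sin_pi_mul_pos hq).ne'

lemma abs_mul_cotPi_le {x C q : ℝ} (hq : q ∈ Set.Ioo (0 : ℝ) 1)
    (hx : |x| ≤ C * Real.sin (π * q) ^ (3 / 4 : ℝ)) :
    |x * cotPi q| ≤ C * Real.sin (π * q) ^ (-1 / 4 : ℝ) := by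
  have hs := sin_pi_mul_pos hq
  rw [cotPi, abs_mul, abs_div, abs_of_pos hs]
  have h1 : |Real.cos (π * q)| / Real.sin (π * q) ≤ (Real.sin (π * q))⁻¹ := by
    rw [div_eq_mul_inv]
    exact mul_le_of_le_one_left (by positivity) (Real.abs_cos_le_one _)
  refine (mul_le_mul hx h1 (by positivity) ((abs_nonneg _).trans hx)).trans_eq ?_
  rw [show (-1 / 4 : ℝ) = 3 / 4 - 1 by norm_num, Real.rpow_sub_one hs.ne']
  ring

lemma mildEndpoints_mul_cotPi {f : ℝ → ℝ} (hf : ContinuousOn f (Set.Ioo 0 1)) {C : ℝ}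
    (hC : ∀ q ∈ Set.Ioo (0 : ℝ) 1, |f q| ≤ C * Real.sin (π * q) ^ (3 / 4 : ℝ)) :
    MildEndpoints fun q => f q * cotPi q :=
  ⟨hf.mul continuousOn_cotPi, C, fun q hq => abs_mul_cotPi_le hq (hC q hq)⟩

lemma mildEndpoints_of_continuous {f : ℝ → ℝ} (hf : Continuous f) {C : ℝ}
    (hC : ∀ q, |f q| ≤ C) : MildEndpoints f := by
  refine ⟨hf.continuousOn, C, fun q hq => (hC q).trans ?_⟩
  have hs := sin_pi_mul_pos hq
  have h0 : 0 ≤ C := (abs_nonneg _).trans (hC q)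
  exact le_mul_of_one_le_right h0
    (Real.one_le_rpow_of_pos_of_le_one_of_nonpos hs (Real.sin_le_one _) (by norm_num))

lemma mildEndpoints_one : MildEndpoints fun _ : ℝ => (1 : ℝ) :=
  mildEndpoints_of_continuous continuous_const (C := 1) (by simp)

lemma mildEndpoints_sin_mul_cotPi (r : ℕ) :
    MildEndpoints fun q => Real.sin (2 * π * q * r) * cotPi q := by
  refine mildEndpoints_mul_cotPi (by fun_prop) (C := 2 * (r : ℝ) ^ (3 / 4 : ℝ)) fun q hq => ?_
  have h := abs_sin_two_pi_mul_le q r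
  rwa [abs_of_pos (sin_pi_mul_pos hq)] at h

lemma intervalIntegrable_sin_mul_cotPi (r : ℕ) :
    IntervalIntegrable (fun q => Real.sin (2 * π * q * r) * cotPi q) volume 0 1 := by
  simpa using (mildEndpoints_sin_mul_cotPi r).intervalIntegrable_mul_mul mildEndpoints_one
    mildEndpoints_one

lemma integral_cos_two_pi_mul {N : ℕ} (hN : N ≠ 0) :
    ∫ q in (0 : ℝ)..1, Real.cos (2 * π * q * N) = 0 := by
  have hc : (2 * π * N : ℝ) ≠ 0 := by positivity
  have h : ∀ q : ℝ, Real.cos (2 * π * q * N) = Real.cos (2 * π * N * q) := fun q => by ring_nf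
  simp_rw [h]
  rw [intervalIntegral.integral_comp_mul_left _ hc, integral_cos]
  rw [show 2 * π * (N : ℝ) * 1 = (2 * N : ℕ) * π by push_cast; ring, Real.sin_nat_mul_pi]
  simp

lemma integral_congr_Ioo {f g : ℝ → ℝ} (h : Set.EqOn f g (Set.Ioo 0 1)) :
    ∫ q in (0 : ℝ)..1, f q = ∫ q in (0 : ℝ)..1, g q := by
  rw [intervalIntegral.integral_of_le zero_le_one, intervalIntegral.integral_of_le zero_le_one,
    integral_Ioc_eq_integral_Ioo, integral_Ioc_eq_integral_Ioo]
  exact setIntegral_congr_fun measurableSet_Ioo h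

lemma integral_sin_mul_cotPi (N : ℕ) :
    ∫ q in (0 : ℝ)..1, Real.sin (2 * π * q * (N + 1 : ℕ)) * cotPi q = 1 := by
  have hstep : ∀ N : ℕ, ∫ q in (0 : ℝ)..1, Real.sin (2 * π * q * (N + 1 : ℕ)) * cotPi q =
      (∫ q in (0 : ℝ)..1, Real.sin (2 * π * q * N) * cotPi q) +
        ∫ q in (0 : ℝ)..1, Real.cos (2 * π * q * N) := by
    intro N
    have hc : ∀ n : ℕ, IntervalIntegrable (fun q : ℝ => Real.cos (2 * π * q * n)) volume 0 1 :=
      fun n => (by fun_prop : Continuous _).intervalIntegrable _ _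
    have h1 := integral_cos_two_pi_mul (Nat.succ_ne_zero N)
    have h2 : ∫ q in (0 : ℝ)..1, Real.cos (2 * π * q * N) =
        ∫ q in (0 : ℝ)..1, (Real.cos (2 * π * q * N) + Real.cos (2 * π * q * (N + 1 : ℕ))) := by
      rw [intervalIntegral.integral_add (hc _) (hc _), h1, add_zero]
    rw [h2, ← intervalIntegral.integral_add (intervalIntegrable_sin_mul_cotPi N) ((hc _).add (hc _))]
    refine integral_congr_Ioo fun q hq => ?_
    have hs := (sin_pi_mul_pos hq).ne'
    simp only [cotPi]
    push_cast
    rw [show 2 * π * q * (N + 1 : ℝ) = 2 * π * q * N + 2 * (π * q) by ring, Real.sin_add,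
      Real.cos_add, Real.sin_two_mul, Real.cos_two_mul]
    field_simp
    have := Real.sin_sq_add_cos_sq (π * q)
    have h3 : Real.cos (π * q) ^ 2 = 1 - Real.sin (π * q) ^ 2 := by linarith
    ring_nf
    rw [show Real.cos (π * q) ^ 3 = Real.cos (π * q) * Real.cos (π * q) ^ 2 by ring, h3]
    ring
  induction N with
  | zero =>
    rw [hstep]
    simp
  | succ N ih =>
    rw [hstep, ih, integral_cos_two_pi_mul (Nat.succ_ne_zero N), add_zero]

lemma integral_sin_mul_cotPi_of_ne_zero {N : ℕ} (hN : N ≠ 0) :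
    ∫ q in (0 : ℝ)..1, Real.sin (2 * π * q * N) * cotPi q = 1 := by
  obtain ⟨n, rfl⟩ := Nat.exists_eq_succ_of_ne_zero hN
  exact integral_sin_mul_cotPi n

/-- The weight `1`, `1/2`, `0` according to `t < r`, `t = r`, `r < t`. -/
noncomputable def orderWeight (r t : ℕ) : ℝ := if t < r then 1 else if t = r then 1 / 2 else 0

lemma integral_sin_mul_cos_mul_cotPi {r t : ℕ} (hr : r ≠ 0) :
    ∫ q in (0 : ℝ)..1, Real.sin (2 * π * q * r) * Real.cos (2 * π * q * t) * cotPi q =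
      orderWeight r t := by
  have hi := intervalIntegrable_sin_mul_cotPi
  have h1 := integral_sin_mul_cotPi_of_ne_zero (N := r + t) (by omega)
  rcases le_total t r with h | h
  · obtain ⟨d, rfl⟩ := Nat.exists_eq_add_of_le h
    have he : ∀ q : ℝ, Real.sin (2 * π * q * (t + d : ℕ)) * Real.cos (2 * π * q * t) * cotPi q =
        1 / 2 * (Real.sin (2 * π * q * (t + d + t : ℕ)) * cotPi q +
          Real.sin (2 * π * q * d) * cotPi q) := by
      intro q
      have e1 : 2 * π * q * (t + d + t : ℕ) = 2 * π * q * (t + d : ℕ) + 2 * π * q * t := by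
        push_cast; ring
      have e2 : 2 * π * q * d = 2 * π * q * (t + d : ℕ) - 2 * π * q * t := by
        push_cast; ring
      rw [e1, e2, Real.sin_add, Real.sin_sub]
      ring
    simp_rw [he]
    rw [intervalIntegral.integral_const_mul, intervalIntegral.integral_add (hi _) (hi _), h1]
    rcases Nat.eq_zero_or_pos d with rfl | hd
    · simp [orderWeight]
    · rw [integral_sin_mul_cotPi_of_ne_zero hd.ne']
      simp [orderWeight, hd]
      norm_num
  · obtain ⟨d, rfl⟩ := Nat.exists_eq_add_of_le h
    have he : ∀ q : ℝ, Real.sin (2 * π * q * r) * Real.cos (2 * π * q * (r + d : ℕ)) * cotPi q =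
        1 / 2 * (Real.sin (2 * π * q * (r + (r + d) : ℕ)) * cotPi q -
          Real.sin (2 * π * q * d) * cotPi q) := by
      intro q
      have e1 : 2 * π * q * (r + (r + d) : ℕ) = 2 * π * q * (r + d : ℕ) + 2 * π * q * r := by
        push_cast; ring
      have e2 : 2 * π * q * d = 2 * π * q * (r + d : ℕ) - 2 * π * q * r := by
        push_cast; ring
      rw [e1, e2, Real.sin_add, Real.sin_sub]
      ring
    simp_rw [he]
    rw [intervalIntegral.integral_const_mul, intervalIntegral.integral_sub (hi _) (hi _), h1]
    rcases Nat.eq_zero_or_pos d with rfl | hd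
    · simp [orderWeight]
    · rw [integral_sin_mul_cotPi_of_ne_zero hd.ne']
      simp [orderWeight, hd.ne']

lemma hasSum_integral_sinPoly_cosPoly_cotPi {m n : ℕ} (hm : 2 ≤ m) (hn : 2 ≤ n) :
    HasSum (fun p : ℕ × ℕ => 1 / (p.1 : ℝ) ^ m * (1 / (p.2 : ℝ) ^ n) * orderWeight p.1 p.2)
      (∫ q in (0 : ℝ)..1, sinPoly m q * cosPoly n q * cotPi q) := by
  set F : ℕ × ℕ → ℝ → ℝ := fun p q => Real.sin (2 * π * q * p.1) / (p.1 : ℝ) ^ m *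
    (Real.cos (2 * π * q * p.2) / (p.2 : ℝ) ^ n) * cotPi q with hF
  have hns : Summable fun t : ℕ => 1 / (t : ℝ) ^ n :=
    Real.summable_one_div_nat_pow.2 (by omega)
  have hsum : Summable fun p : ℕ × ℕ =>
      2 * (p.1 : ℝ) ^ (3 / 4 : ℝ) / (p.1 : ℝ) ^ m * (1 / (p.2 : ℝ) ^ n) :=
    (summable_rpow_div_pow hm).mul_of_nonneg hns (fun _ => by positivity) (fun _ => by positivity)
  have hsin : IntervalIntegrable (fun q => Real.sin (π * q) ^ (-1 / 4 : ℝ)) volume 0 1 := by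
    have : MildEndpoints fun q => Real.sin (π * q) ^ (-1 / 4 : ℝ) := by
      refine ⟨ContinuousOn.rpow_const (by fun_prop)
        fun q hq => Or.inl (sin_pi_mul_pos hq).ne', 1, fun q hq => ?_⟩
      rw [one_mul, Real.norm_of_nonneg (Real.rpow_nonneg (sin_pi_mul_pos hq).le _)]
    simpa using this.intervalIntegrable_mul_mul mildEndpoints_one mildEndpoints_one
  have hbd : ∀ p : ℕ × ℕ, ∀ q ∈ Set.Ioo (0 : ℝ) 1, ‖F p q‖ ≤
      2 * (p.1 : ℝ) ^ (3 / 4 : ℝ) / (p.1 : ℝ) ^ m * (1 / (p.2 : ℝ) ^ n) *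
        Real.sin (π * q) ^ (-1 / 4 : ℝ) := by
    intro p q hq
    refine abs_mul_cotPi_le hq ?_
    have h := abs_sin_two_pi_mul_le q p.1
    rw [abs_of_pos (sin_pi_mul_pos hq)] at h
    have hc := Real.abs_cos_le_one (2 * π * q * p.2)
    have hs := sin_pi_mul_pos hq
    rw [abs_mul, abs_div, abs_div, abs_pow, abs_pow, Nat.abs_cast, Nat.abs_cast]
    calc _ ≤ 2 * (p.1 : ℝ) ^ (3 / 4 : ℝ) * Real.sin (π * q) ^ (3 / 4 : ℝ) / (p.1 : ℝ) ^ m *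
          (1 / (p.2 : ℝ) ^ n) := by gcongr
      _ = _ := by ring
  have hae : ∀ᵐ q ∂(volume : Measure ℝ), q ∈ Set.uIoc (0 : ℝ) 1 → q ∈ Set.Ioo (0 : ℝ) 1 := by
    have h1 : ({(1 : ℝ)}ᶜ : Set ℝ) ∈ ae (volume : Measure ℝ) :=
      compl_mem_ae_iff.2 (measure_singleton (1 : ℝ))
    filter_upwards [h1] with q hq1 hq
    rw [Set.uIoc_of_le zero_le_one] at hq
    exact ⟨hq.1, lt_of_le_of_ne hq.2 hq1⟩
  have key := intervalIntegral.hasSum_integral_of_dominated_convergence (μ := volume)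
    (a := 0) (b := 1) (F := F) (f := fun q => sinPoly m q * cosPoly n q * cotPi q)
    (fun p q => 2 * (p.1 : ℝ) ^ (3 / 4 : ℝ) / (p.1 : ℝ) ^ m * (1 / (p.2 : ℝ) ^ n) *
        Real.sin (π * q) ^ (-1 / 4 : ℝ))
    (fun p => by
      refine Measurable.aestronglyMeasurable ?_
      simp only [hF, cotPi]
      fun_prop)
    (fun p => by
      filter_upwards [hae] with q hq hq'
      exact hbd p q (hq hq'))
    (Filter.Eventually.of_forall fun q _ => hsum.mul_right _)
    (by
      simp_rw [tsum_mul_right]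
      exact hsin.const_mul _)
    (by
      filter_upwards [hae] with q hq hq'
      refine HasSum.mul_right _ ?_
      refine (hasSum_sinPoly hm q).mul (hasSum_cosPoly hn q) ?_
      have h1 : Summable fun r : ℕ => 1 / (r : ℝ) ^ m :=
        Real.summable_one_div_nat_pow.2 (by omega)
      refine Summable.of_norm_bounded
        (h1.mul_of_nonneg hns (fun _ => by positivity) (fun _ => by positivity)) fun p => ?_
      rw [norm_mul, norm_div, norm_div, norm_pow, norm_pow, Real.norm_natCast, Real.norm_natCast,
        Real.norm_eq_abs, Real.norm_eq_abs]
      gcongr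
      · exact Real.abs_sin_le_one _
      · exact Real.abs_cos_le_one _)
  refine key.congr_fun fun p => ?_
  rcases Nat.eq_zero_or_pos p.1 with h0 | h0
  · simp [hF, h0, show m ≠ 0 by omega]
  · rw [← integral_sin_mul_cos_mul_cotPi h0.ne', ← intervalIntegral.integral_const_mul]
    congr 1
    ext q
    simp only [hF]
    ring

lemma sin_pi_mul_rpow_tendsto {a : ℝ} (ha : Real.sin (π * a) = 0) (s : Set ℝ) (C : ℝ) :
    Filter.Tendsto (fun q => C * Real.sin (π * q) ^ (1 / 4 : ℝ)) (nhdsWithin a s) (nhds 0) := by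
  have hc : Continuous fun q : ℝ => C * Real.sin (π * q) ^ (1 / 4 : ℝ) :=
    continuous_const.mul
      (Continuous.rpow_const (by fun_prop) fun _ => Or.inr (by norm_num))
  have h := hc.tendsto a
  rw [ha, Real.zero_rpow (by norm_num), mul_zero] at h
  exact h.mono_left nhdsWithin_le_nhds

lemma hasDerivAt_K {q : ℝ} (hq : q ∈ Set.Ioo (0 : ℝ) 1) : HasDerivAt K (π * cotPi q) q := by
  have h1 : HasDerivAt (fun x : ℝ => π * x) π q := by
    simpa using (hasDerivAt_id q).const_mul π
  refine (h1.sin.log (sin_pi_mul_pos hq).ne').congr_deriv ?_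
  rw [cotPi]
  ring

lemma integral_sinPoly_cosPoly_cotPi_eq {k l : ℕ} (hk : 1 ≤ k) (hl : 1 ≤ l) :
    ∫ q in (0 : ℝ)..1, sinPoly (k + 1) q * cosPoly (l + 1) q * cotPi q =
      -2 * ((∫ q in (0 : ℝ)..1, cosPoly k q * cosPoly (l + 1) q * K q) -
        ∫ q in (0 : ℝ)..1, sinPoly (k + 1) q * sinPoly l q * K q) := by
  obtain ⟨C, hC⟩ := abs_sinPoly_le (k := k + 1) (by omega)
  have hs := mildEndpoints_sinPoly (k := k + 1) (by omega)
  have hc := mildEndpoints_cosPoly (k := l + 1) (by omega)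
  have hi1 := (mildEndpoints_cosPoly hk).intervalIntegrable_mul_mul hc mildEndpoints_K
  have hi2 := hs.intervalIntegrable_mul_mul (mildEndpoints_sinPoly hl) mildEndpoints_K
  have hi3 : IntervalIntegrable (fun q => sinPoly (k + 1) q * cosPoly (l + 1) q * cotPi q)
      volume 0 1 :=
    ((mildEndpoints_mul_cotPi hs.1 hC).intervalIntegrable_mul_mul hc mildEndpoints_one).congr
      fun q _ => by ring
  have hbound : ∃ D : ℝ, ∀ q ∈ Set.Ioo (0 : ℝ) 1,
      ‖sinPoly (k + 1) q * cosPoly (l + 1) q * K q‖ ≤ D * Real.sin (π * q) ^ (1 / 4 : ℝ) := by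
    obtain ⟨-, D, hD⟩ := hc
    obtain ⟨-, E, hE⟩ := mildEndpoints_K
    refine ⟨C * D * E, fun q hq => ?_⟩
    have hsin := sin_pi_mul_pos hq
    have h1 := hC q hq
    have h2 := hD q hq
    have h3 := hE q hq
    have h4 := (abs_nonneg _).trans h1
    have h5 := (norm_nonneg _).trans h2
    rw [norm_mul, norm_mul, Real.norm_eq_abs (sinPoly _ _)]
    refine (mul_le_mul (mul_le_mul h1 h2 (norm_nonneg _) h4) h3 (norm_nonneg _)
      (mul_nonneg h4 h5)).trans_eq ?_
    rw [show (1 / 4 : ℝ) = 3 / 4 + -1 / 4 + -1 / 4 by norm_num, Real.rpow_add hsin,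
      Real.rpow_add hsin]
    ring
  obtain ⟨D, hD⟩ := hbound
  have h := intervalIntegral.integral_eq_sub_of_hasDerivAt_of_tendsto (a := 0) (b := 1)
    (f := fun q => sinPoly (k + 1) q * cosPoly (l + 1) q * K q)
    (f' := fun q => 2 * π * (cosPoly k q * cosPoly (l + 1) q * K q) -
      2 * π * (sinPoly (k + 1) q * sinPoly l q * K q) +
      π * (sinPoly (k + 1) q * cosPoly (l + 1) q * cotPi q)) (fa := 0) (fb := 0) zero_lt_one
    (fun q hq => by
      refine (((hasDerivAt_sinPoly hq hk).mul (hasDerivAt_cosPoly hq hl)).mul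
        (hasDerivAt_K hq)).congr_deriv ?_
      simp only [Pi.mul_apply]
      ring)
    (((hi1.const_mul _).sub (hi2.const_mul _)).add (hi3.const_mul _))
    (squeeze_zero_norm' (by
        filter_upwards [Ioo_mem_nhdsGT (zero_lt_one (α := ℝ))] with q hq using hD q hq)
      (sin_pi_mul_rpow_tendsto (by simp) _ D))
    (squeeze_zero_norm' (by
        filter_upwards [Ioo_mem_nhdsLT (zero_lt_one (α := ℝ))] with q hq using hD q hq)
      (sin_pi_mul_rpow_tendsto (by simp) _ D))
  rw [intervalIntegral.integral_add ((hi1.const_mul _).sub (hi2.const_mul _)) (hi3.const_mul _),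
    intervalIntegral.integral_sub (hi1.const_mul _) (hi2.const_mul _),
    intervalIntegral.integral_const_mul, intervalIntegral.integral_const_mul,
    intervalIntegral.integral_const_mul] at h
  have hpi := Real.pi_pos
  refine mul_left_cancel₀ hpi.ne' ?_
  linarith

lemma K_one_sub (q : ℝ) : K (1 - q) = K q := by
  rw [K, K, mul_one_sub, Real.sin_pi_sub]

lemma integral_mul_symm_K {f g : ℝ → ℝ} {ε : ℝ} (hf : MildEndpoints f) (hg : MildEndpoints g)
    (hgε : ∀ q, g (1 - q) = ε * g q) :
    ∫ q in (0 : ℝ)..1, f q * g q * K q =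
      1 / 2 * ∫ q in (0 : ℝ)..1, (f q + ε * f (1 - q)) * g q * K q := by
  have hi := hf.intervalIntegrable_mul_mul hg mildEndpoints_K
  have hi' := (hf.comp_one_sub.intervalIntegrable_mul_mul hg mildEndpoints_K).const_mul ε
  have h : ∫ q in (0 : ℝ)..1, f q * g q * K q =
      ∫ q in (0 : ℝ)..1, ε * (f (1 - q) * g q * K q) := by
    have := intervalIntegral.integral_comp_sub_left (a := 0) (b := 1)
      (fun q => f q * g q * K q) 1
    simp only [sub_self, sub_zero, hgε, K_one_sub] at this
    rw [← this]
    congr 1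
    ext q
    ring
  have he : ∫ q in (0 : ℝ)..1, (f q + ε * f (1 - q)) * g q * K q =
      (∫ q in (0 : ℝ)..1, f q * g q * K q) +
        ∫ q in (0 : ℝ)..1, ε * (f (1 - q) * g q * K q) := by
    rw [← intervalIntegral.integral_add hi hi']
    congr 1
    ext q
    ring
  rw [he, ← h]
  ring

lemma I_AA_add_J_AA (a b : ℕ) :
    I_AA (2 * a + 1) (2 * b + 1) + J_AA (2 * a + 1) (2 * b + 1) =
      (-1) ^ (a + b) * (2 * ((2 * a + 1).factorial * (2 * b + 1).factorial) /
        (2 * π) ^ (2 * a + 1 + (2 * b + 1))) *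
        ∫ q in (0 : ℝ)..1, cosPoly (2 * a + 1) q * cosPoly (2 * b + 1) q * K q := by
  have hf := mildEndpoints_A (k := 2 * a + 1) (by omega)
  have hg := mildEndpoints_A (k := 2 * b + 1) (by omega)
  have hsum := integral_mul_symm_K hf (hg.add hg.comp_one_sub) (ε := 1) fun q => by
    rw [sub_sub_cancel]
    ring
  have h1 : (∫ q in (0 : ℝ)..1,
      A (2 * a + 1) q * (A (2 * b + 1) q + A (2 * b + 1) (1 - q)) * K q) =
      (∫ q in (0 : ℝ)..1, A (2 * a + 1) q * A (2 * b + 1) q * K q) +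
        ∫ q in (0 : ℝ)..1, A (2 * a + 1) q * A (2 * b + 1) (1 - q) * K q := by
    rw [← intervalIntegral.integral_add (hf.intervalIntegrable_mul_mul hg mildEndpoints_K)
      (hf.intervalIntegrable_mul_mul hg.comp_one_sub mildEndpoints_K)]
    congr 1
    ext q
    ring
  have h2 : (∫ q in (0 : ℝ)..1, (A (2 * a + 1) q + 1 * A (2 * a + 1) (1 - q)) *
      (A (2 * b + 1) q + A (2 * b + 1) (1 - q)) * K q) =
      (-1) ^ a * (2 * π * (2 * a + 1).factorial / (2 * π) ^ (2 * a + 1)) *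
        ((-1) ^ b * (2 * π * (2 * b + 1).factorial / (2 * π) ^ (2 * b + 1))) *
        ∫ q in (0 : ℝ)..1, cosPoly (2 * a + 1) q * cosPoly (2 * b + 1) q * K q := by
    rw [← intervalIntegral.integral_const_mul]
    refine integral_congr_Ioo fun q hq => ?_
    simp only [one_mul]
    rw [A_add_A_one_sub hq, A_add_A_one_sub hq]
    ring
  rw [I_AA, J_AA, ← mul_add, ← h1, hsum, h2, pow_add (2 * π), pow_add (-1 : ℝ)]
  have hpi := Real.pi_pos.ne'
  field_simp
  ring

lemma I_AA_sub_J_AA {a b : ℕ} (ha : 1 ≤ a) (hb : 1 ≤ b) :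
    I_AA (2 * a) (2 * b) - J_AA (2 * a) (2 * b) =
      (-1) ^ (a + b) * (2 * ((2 * a).factorial * (2 * b).factorial) /
        (2 * π) ^ (2 * a + 2 * b)) *
        ∫ q in (0 : ℝ)..1, sinPoly (2 * a) q * sinPoly (2 * b) q * K q := by
  have hf := mildEndpoints_A (k := 2 * a) (by omega)
  have hg := mildEndpoints_A (k := 2 * b) (by omega)
  have hsum := integral_mul_symm_K hf (hg.sub hg.comp_one_sub) (ε := -1) fun q => by
    rw [sub_sub_cancel]
    ring
  have h1 : (∫ q in (0 : ℝ)..1, A (2 * a) q * (A (2 * b) q - A (2 * b) (1 - q)) * K q) =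
      (∫ q in (0 : ℝ)..1, A (2 * a) q * A (2 * b) q * K q) -
        ∫ q in (0 : ℝ)..1, A (2 * a) q * A (2 * b) (1 - q) * K q := by
    rw [← intervalIntegral.integral_sub (hf.intervalIntegrable_mul_mul hg mildEndpoints_K)
      (hf.intervalIntegrable_mul_mul hg.comp_one_sub mildEndpoints_K)]
    congr 1
    ext q
    ring
  have h2 : (∫ q in (0 : ℝ)..1, (A (2 * a) q + -1 * A (2 * a) (1 - q)) *
      (A (2 * b) q - A (2 * b) (1 - q)) * K q) =
      (-1) ^ a * (2 * π * (2 * a).factorial / (2 * π) ^ (2 * a)) *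
        ((-1) ^ b * (2 * π * (2 * b).factorial / (2 * π) ^ (2 * b))) *
        ∫ q in (0 : ℝ)..1, sinPoly (2 * a) q * sinPoly (2 * b) q * K q := by
    rw [← intervalIntegral.integral_const_mul]
    refine integral_congr_Ioo fun q _ => ?_
    simp only [neg_one_mul, ← sub_eq_add_neg]
    rw [A_sub_A_one_sub q ha, A_sub_A_one_sub q hb]
    ring
  rw [I_AA, J_AA, ← mul_sub, ← h1, hsum, h2, pow_add (2 * π), pow_add (-1 : ℝ)]
  have hpi := Real.pi_pos.ne'
  field_simp

lemma hasSum_rzeta_natCast {k : ℕ} (hk : 2 ≤ k) :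
    HasSum (fun r : ℕ => 1 / (r : ℝ) ^ k) (rzeta k) := by
  have hs : Summable fun r : ℕ => 1 / (r : ℝ) ^ k := Real.summable_one_div_nat_pow.2 (by omega)
  have h : rzeta k = ∑' r : ℕ, 1 / (r : ℝ) ^ k := by
    rw [rzeta, Complex.ofReal_natCast, zeta_nat_eq_tsum_of_gt_one (by omega), ← Complex.ofReal_re
      (∑' r : ℕ, 1 / (r : ℝ) ^ k), Complex.ofReal_tsum]
    congr 2
    ext r
    push_cast
    rfl
  exact h ▸ hs.hasSum

lemma hasSum_row {m n : ℕ} (hn : 2 ≤ n) (r : ℕ) :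
    HasSum (fun t : ℕ => 1 / (r : ℝ) ^ m * (1 / (t : ℝ) ^ n) * (1 - orderWeight r t))
      ((∑' s : ℕ, 1 / (r : ℝ) ^ m * (1 / ((s + (r + 1) : ℕ) : ℝ) ^ n)) +
        1 / 2 * (1 / (r : ℝ) ^ (m + n))) := by
  have hs : Summable fun s : ℕ => 1 / (r : ℝ) ^ m * (1 / ((s + (r + 1) : ℕ) : ℝ) ^ n) :=
    ((summable_nat_add_iff (f := fun t : ℕ => 1 / (t : ℝ) ^ n) (r + 1)).2
      (Real.summable_one_div_nat_pow.2 (by omega))).mul_left _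
  have h := hs.hasSum.congr_fun (g := fun s : ℕ => 1 / (r : ℝ) ^ m *
    (1 / ((s + (r + 1) : ℕ) : ℝ) ^ n) * (1 - orderWeight r (s + (r + 1)))) fun s => by
      simp [orderWeight, show ¬ s + (r + 1) < r by omega, show s + (r + 1) ≠ r by omega]
  rw [hasSum_nat_add_iff (f := fun t : ℕ => 1 / (r : ℝ) ^ m * (1 / (t : ℝ) ^ n) *
    (1 - orderWeight r t)), Finset.sum_range_succ, Finset.sum_eq_zero fun t ht => by
      simp [orderWeight, Finset.mem_range.1 ht]] at h
  convert h using 1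
  congr 1
  simp only [orderWeight, lt_irrefl, if_true, if_false, pow_add, one_div, mul_inv]
  ring

lemma T_natCast_zero_natCast {m : ℕ} (hm : m ≠ 0) (n : ℕ) :
    T m 0 n = ∑' r : ℕ, ∑' s : ℕ, 1 / (r : ℝ) ^ m * (1 / ((s + (r + 1) : ℕ) : ℝ) ^ n) := by
  have hrow : ∀ r : ℕ+, (∑' s : ℕ+, 1 / ((r : ℝ) ^ (m : ℝ) * (s : ℝ) ^ (0 : ℝ) *
      ((r : ℝ) + (s : ℝ)) ^ (n : ℝ))) =
      ∑' s : ℕ, 1 / ((r : ℕ) : ℝ) ^ m * (1 / ((s + ((r : ℕ) + 1) : ℕ) : ℝ) ^ n) := by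
    intro r
    have h := tsum_pnat_eq_tsum_succ (f := fun s : ℕ =>
      1 / ((r : ℕ) : ℝ) ^ m * (1 / ((s + (r : ℕ) : ℕ) : ℝ) ^ n))
    simp only [add_assoc, add_comm 1 (r : ℕ)] at h
    rw [← h]
    congr 1
    ext s
    rw [Real.rpow_zero, Real.rpow_natCast, Real.rpow_natCast, mul_one, one_div_mul_one_div,
      Nat.cast_add, add_comm (r : ℝ)]
  simp only [T, hrow]
  refine tsum_pnat_eq_tsum_of_eq_zero (f := fun r : ℕ =>
    ∑' s : ℕ, 1 / (r : ℝ) ^ m * (1 / ((s + (r + 1) : ℕ) : ℝ) ^ n)) ?_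
  simp [hm]

lemma T_natCast_zero_natCast_eq {m n : ℕ} (hm : 2 ≤ m) (hn : 2 ≤ n) :
    T m 0 n = rzeta m * rzeta n - 1 / 2 * rzeta (m + n) -
      ∫ q in (0 : ℝ)..1, sinPoly m q * cosPoly n q * cotPi q := by
  have hp := (hasSum_rzeta_natCast hm).mul (hasSum_rzeta_natCast hn)
    ((hasSum_rzeta_natCast hm).summable.mul_of_nonneg (hasSum_rzeta_natCast hn).summable
      (fun _ => by positivity) (fun _ => by positivity))
  have h := (hp.sub (hasSum_integral_sinPoly_cosPoly_cotPi hm hn)).congr_fun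
    (g := fun p : ℕ × ℕ => 1 / (p.1 : ℝ) ^ m * (1 / (p.2 : ℝ) ^ n) *
      (1 - orderWeight p.1 p.2)) fun p => by ring
  have hz := (hasSum_rzeta_natCast (k := m + n) (by omega)).mul_left (1 / 2)
  have h2 := (h.prod_fiberwise fun r => hasSum_row hn r).sub hz
  simp only [add_sub_cancel_right] at h2
  rw [T_natCast_zero_natCast (by omega), h2.tsum_eq]
  push_cast
  ring

theorem tornheim_T_m_0_n_even_odd (m n : ℕ) (hm : 2 ≤ m) (hn : 2 ≤ n)
    (hme : Even m) (hno : Odd n) :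
    T m 0 n = rzeta m * rzeta n - (1 / 2) * rzeta (m + n) +
      (-1 : ℝ) ^ ((m + n) / 2) * ((2 * π) ^ (m + n - 1) / (m.factorial * n.factorial)) *
        (-(m * I_AA (m - 1) n) - n * I_AA m (n - 1)
          - m * J_AA (m - 1) n + n * J_AA m (n - 1)) := by
  rw [T_natCast_zero_natCast_eq hm hn]
  obtain ⟨a, rfl⟩ : ∃ a, m = 2 * a + 1 + 1 := by
    obtain ⟨a, ha⟩ := hme
    exact ⟨a - 1, by omega⟩
  obtain ⟨b, rfl⟩ := hno
  have hb : 1 ≤ b := by omega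
  have h1 := I_AA_add_J_AA a b
  have h2 := I_AA_sub_J_AA (a := a + 1) (b := b) (by omega) hb
  rw [show 2 * (a + 1) = 2 * a + 1 + 1 by ring] at h2
  rw [integral_sinPoly_cosPoly_cotPi_eq (by omega) (by omega)]
  rw [show (2 * a + 1 + 1 + (2 * b + 1)) / 2 = a + b + 1 by omega,
    show 2 * a + 1 + 1 + (2 * b + 1) - 1 = 2 * a + 1 + (2 * b + 1) by omega]
  simp only [Nat.add_sub_cancel]
  generalize (∫ q in (0 : ℝ)..1, cosPoly (2 * a + 1) q * cosPoly (2 * b + 1) q * K q) = X at *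
  generalize (∫ q in (0 : ℝ)..1, sinPoly (2 * a + 1 + 1) q * sinPoly (2 * b) q * K q) = Y at *
  have hI : I_AA (2 * a + 1) (2 * b + 1) = _ - J_AA (2 * a + 1) (2 * b + 1) := eq_sub_of_add_eq h1
  have hJ : I_AA (2 * a + 1 + 1) (2 * b) = _ + J_AA (2 * a + 1 + 1) (2 * b) :=
    eq_add_of_sub_eq h2
  rw [hI, hJ]
  have hs : ((-1 : ℝ) ^ (a + b)) ^ 2 = 1 := by rw [← pow_mul, mul_comm, pow_mul]; simp
  have hpi := Real.pi_pos.ne'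
  have hF : ((2 * a + 1).factorial : ℝ) ≠ 0 := by positivity
  have hG : ((2 * b).factorial : ℝ) ≠ 0 := by positivity
  rw [Nat.factorial_succ (2 * a + 1), Nat.factorial_succ (2 * b)]
  rw [show a + 1 + b = a + b + 1 by ring, pow_succ (-1 : ℝ) (a + b),
    show 2 * a + 1 + 1 + 2 * b = 2 * a + 1 + (2 * b + 1) by ring]
  generalize (-1 : ℝ) ^ (a + b) = ε at *
  push_cast
  field_simp
  ring_nf
  rw [hs]
  ring
end

section
/- Let ε > 0 and let a, c be real numbers with a > 1 and c > 1. Then I(a,ε,c) = −(1/ε) [ (a−1) I(a−1, ε+1, c) + (c−1) I(a, ε+1, c−1) ], and similarly J(a,ε,c) = −(1/ε) [ (a−1) J(a−1, ε+1, c) − (c−1) J(a, ε+1, c−1) ]. -/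
open Real MeasureTheory

/-- `I(a,b,c) = ∫₀¹ ζ(1-a,q) ζ(1-b,q) ζ(1-c,q) dq`. -/
noncomputable def Iint (a b c : ℝ) : ℝ :=
  ∫ q in (0:ℝ)..1, hzeta (1 - a) q * hzeta (1 - b) q * hzeta (1 - c) q

/-- `J(a,b,c) = ∫₀¹ ζ(1-a,q) ζ(1-b,q) ζ(1-c,1-q) dq`. -/
noncomputable def Jint (a b c : ℝ) : ℝ :=
  ∫ q in (0:ℝ)..1, hzeta (1 - a) q * hzeta (1 - b) q * hzeta (1 - c) (1 - q)

open Set Filter Topology HurwitzZeta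

theorem continuous_intervalIntegral_of_continuousOn {X : Type*} [TopologicalSpace X]
    {F : X → ℝ → ℂ} (hF : ContinuousOn (Function.uncurry F) (univ ×ˢ Icc 0 1)) :
    Continuous fun x ↦ ∫ s in (0:ℝ)..1, F x s := by
  have h : Continuous (Function.uncurry fun (x : X) (s : ℝ) ↦
      F x (projIcc (0:ℝ) 1 zero_le_one s)) :=
    hF.comp_continuous (f := fun p : X × ℝ ↦ (p.1, ((projIcc (0:ℝ) 1 zero_le_one p.2 : Icc (0:ℝ) 1) : ℝ)))
      (continuous_fst.prodMk (continuous_subtype_val.comp (continuous_projIcc.comp continuous_snd)))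
      fun p ↦ ⟨mem_univ _, Subtype.coe_prop _⟩
  convert intervalIntegral.continuous_parametric_intervalIntegral_of_continuous' (μ := volume) h 0 1 using 2 with x
  refine intervalIntegral.integral_congr fun s hs ↦ ?_
  rw [uIcc_of_le zero_le_one] at hs
  simp [projIcc_of_mem zero_le_one hs]

theorem differentiableOn_intervalIntegral {U : Set ℂ} (hU : IsOpen U) {F : ℂ → ℝ → ℂ}
    (hF : ContinuousOn (Function.uncurry F) (U ×ˢ Icc 0 1))
    (hd : ∀ s ∈ Icc (0:ℝ) 1, DifferentiableOn ℂ (F · s) U) :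
    DifferentiableOn ℂ (fun z ↦ ∫ s in (0:ℝ)..1, F z s) U := by
  intro z₀ hz₀
  obtain ⟨r, hr, hrU⟩ := Metric.nhds_basis_closedBall.mem_iff.1 (hU.mem_nhds hz₀)
  obtain ⟨M, hM⟩ := ((isCompact_closedBall z₀ r).prod (isCompact_Icc (a := (0:ℝ)) (b := 1))).exists_bound_of_continuousOn
    (hF.mono (prod_mono hrU le_rfl))
  have hcont : ∀ z ∈ U, ContinuousOn (F z) (Icc 0 1) := fun z hz ↦
    hF.comp (f := fun s ↦ (z, s)) (by fun_prop) fun s hs ↦ ⟨hz, hs⟩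
  have hmeas : ∀ z ∈ U, AEStronglyMeasurable (F z) (volume.restrict (uIoc 0 1)) := fun z hz ↦ by
    rw [uIoc_of_le zero_le_one]
    exact ((hcont z hz).mono Ioc_subset_Icc_self).aestronglyMeasurable measurableSet_Ioc
  have hderiv : ∀ z ∈ U, ∀ s ∈ Icc (0:ℝ) 1, HasDerivAt (F · s) (deriv (F · s) z) z :=
    fun z hz s hs ↦ ((hd s hs).differentiableAt (hU.mem_nhds hz)).hasDerivAt
  have hball : ∀ z ∈ Metric.ball z₀ (r / 2), Metric.closedBall z (r / 2) ⊆ Metric.closedBall z₀ r := by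
    intro z hz
    refine Metric.closedBall_subset_closedBall' ?_
    rw [Metric.mem_ball] at hz; linarith
  refine (intervalIntegral.hasDerivAt_integral_of_dominated_loc_of_deriv_le (μ := volume) (𝕜 := ℂ)
    (F := F) (F' := fun z s ↦ deriv (F · s) z) (bound := fun _ ↦ M / (r / 2)) (Metric.ball_mem_nhds z₀ (half_pos hr))
    ?_ ?_ ?_ ?_ ?_ ?_).2.differentiableAt.differentiableWithinAt
  · exact (hU.eventually_mem hz₀).mono hmeas
  · exact (by rw [uIcc_of_le zero_le_one]; exact hcont _ hz₀ : ContinuousOn (F z₀) (uIcc 0 1)).intervalIntegrable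
  · set h : ℕ → ℂ := fun n ↦ ((r * (1 / ((n : ℝ) + 1)) : ℝ) : ℂ)
    have hpos : ∀ n : ℕ, 0 < r * (1 / ((n : ℝ) + 1)) := fun n ↦ by positivity
    have hh0 : Tendsto h atTop (𝓝 0) := by
      have := (tendsto_one_div_add_atTop_nhds_zero_nat (𝕜 := ℝ)).const_mul r
      rw [mul_zero] at this
      have hc := (Complex.continuous_ofReal.tendsto 0).comp this
      rw [Complex.ofReal_zero] at hc
      exact hc
    have hh : Tendsto h atTop (𝓝[≠] 0) :=
      tendsto_nhdsWithin_iff.2 ⟨hh0, .of_forall fun n ↦ by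
        simpa [h] using ⟨hr.ne', by exact_mod_cast (Nat.succ_ne_zero n)⟩⟩
    have hmem : ∀ n, z₀ + h n ∈ U := fun n ↦ hrU <| by
      rw [Metric.mem_closedBall, dist_eq_norm, add_sub_cancel_left, Complex.norm_real,
        norm_of_nonneg (hpos n).le]
      have : 1 / ((n : ℝ) + 1) ≤ 1 := by rw [div_le_one (by positivity)]; linarith [n.cast_nonneg (α := ℝ)]
      nlinarith
    refine aestronglyMeasurable_of_tendsto_ae atTop
      (f := fun n s ↦ (h n)⁻¹ • (F (z₀ + h n) s - F z₀ s))
      (fun n ↦ ((hmeas _ (hmem n)).sub (hmeas _ hz₀)).const_smul (h n)⁻¹) ?_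
    refine (ae_restrict_iff' measurableSet_uIoc).2 (.of_forall fun s hs ↦ ?_)
    rw [uIoc_of_le zero_le_one] at hs
    exact (hasDerivAt_iff_tendsto_slope_zero.1 (hderiv z₀ hz₀ s (Ioc_subset_Icc_self hs))).comp hh
  · refine .of_forall fun s hs z hz ↦ ?_
    rw [uIoc_of_le zero_le_one] at hs
    have hs' := Ioc_subset_Icc_self hs
    refine Complex.norm_deriv_le_of_forall_mem_sphere_norm_le (half_pos hr) ?_ fun w hw ↦
      hM (w, s) ⟨hball z hz (Metric.sphere_subset_closedBall hw), hs'⟩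
    refine DifferentiableOn.diffContOnCl ?_
    rw [closure_ball _ (half_pos hr).ne']
    exact (hd s hs').mono ((hball z hz).trans hrU)
  · exact intervalIntegrable_const
  · refine .of_forall fun s hs z hz ↦ ?_
    rw [uIoc_of_le zero_le_one] at hs
    exact hderiv z (hrU (hball z hz (Metric.mem_closedBall_self (half_pos hr).le))) s (Ioc_subset_Icc_self hs)
/-- The Dirichlet series of `ζ(w, t)` with its first term split off. -/
theorem hurwitzZeta_eq_cpow_add_tsum {t : ℝ} (ht : t ∈ Ioo (0:ℝ) 1) {w : ℂ} (hw : 1 < w.re) :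
    hurwitzZeta (t : UnitAddCircle) w =
      (t : ℂ) ^ (-w) + ∑' n : ℕ, ((n + 1 + t : ℝ) : ℂ) ^ (-w) := by
  have h := hasSum_hurwitzZeta_of_one_lt_re (Ioo_subset_Icc_self ht) hw
  rw [← h.tsum_eq, h.summable.tsum_eq_zero_add]
  simp [Complex.cpow_neg]

theorem norm_natCast_add_cpow_le {w : ℂ} {σ t : ℝ} (hσ : 0 ≤ σ) (hw : σ ≤ w.re) (ht : 0 < t) (n : ℕ) :
    ‖((n + 1 + t : ℝ) : ℂ) ^ (-w)‖ ≤ ((n + 1 : ℕ) : ℝ) ^ (-σ) := by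
  have hn : (0:ℝ) ≤ n := n.cast_nonneg
  rw [Complex.norm_cpow_eq_rpow_re_of_pos (by positivity), Complex.neg_re]
  push_cast
  calc ((n:ℝ) + 1 + t) ^ (-w.re) ≤ ((n:ℝ) + 1 + t) ^ (-σ) :=
        rpow_le_rpow_of_exponent_le (by linarith) (by linarith)
    _ ≤ _ := rpow_le_rpow_of_nonpos (by positivity) (by linarith) (by linarith)

theorem summable_natCast_succ_rpow {σ : ℝ} (hσ : 1 < σ) :
    Summable fun n : ℕ ↦ ((n + 1 : ℕ) : ℝ) ^ (-σ) :=
  (summable_nat_add_iff 1).2 (Real.summable_nat_rpow.2 (by linarith))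

theorem continuousOn_hurwitzZeta_of_one_lt_re :
    ContinuousOn (fun p : ℂ × ℝ ↦ hurwitzZeta (p.2 : UnitAddCircle) p.1)
      ({w : ℂ | 1 < w.re} ×ˢ Ioo (0:ℝ) 1) := by
  rintro ⟨w₀, t₀⟩ ⟨hw₀ : 1 < w₀.re, ht₀⟩
  obtain ⟨σ, hσ, hσw⟩ := exists_between hw₀
  have hopen : IsOpen ({w : ℂ | σ < w.re} ×ˢ Ioo (0:ℝ) 1) :=
    (isOpen_lt continuous_const Complex.continuous_re).prod isOpen_Ioo
  have hc : ContinuousOn (fun p : ℂ × ℝ ↦ (p.2 : ℂ) ^ (-p.1) +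
      ∑' n : ℕ, ((n + 1 + p.2 : ℝ) : ℂ) ^ (-p.1)) ({w : ℂ | σ < w.re} ×ˢ Ioo (0:ℝ) 1) := by
    refine .add ?_ (continuousOn_tsum (fun n ↦ ?_) (summable_natCast_succ_rpow hσ)
      fun n p hp ↦ norm_natCast_add_cpow_le (by linarith) (le_of_lt hp.1) hp.2.1 n)
    · refine ContinuousOn.cpow (by fun_prop) (by fun_prop) fun p hp ↦ ?_
      exact Complex.ofReal_mem_slitPlane.2 hp.2.1
    · refine ContinuousOn.cpow (by fun_prop) (by fun_prop) fun p hp ↦ ?_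
      have := hp.2.1
      exact Complex.ofReal_mem_slitPlane.2 (by positivity)
  have hmem : (w₀, t₀) ∈ {w : ℂ | σ < w.re} ×ˢ Ioo (0:ℝ) 1 := ⟨hσw, ht₀⟩
  refine ContinuousAt.continuousWithinAt ?_
  refine (hc.continuousAt (hopen.mem_nhds hmem)).congr ?_
  filter_upwards [hopen.mem_nhds hmem] with p hp
  exact (hurwitzZeta_eq_cpow_add_tsum hp.2 (hσ.trans hp.1)).symm

theorem hasDerivAt_ofReal_cpow_neg {z : ℂ} {x : ℝ} (hx : 0 < x) :
    HasDerivAt (fun t : ℝ ↦ (t : ℂ) ^ (-z)) (-z * (x : ℂ) ^ (-(z + 1))) x := by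
  have := (Complex.hasStrictDerivAt_cpow_const (c := -z) (Complex.ofReal_mem_slitPlane.2 hx)).hasDerivAt.comp_ofReal
  rwa [show -z - 1 = -(z + 1) by ring] at this

theorem hasDerivAt_hurwitzZeta_of_one_lt_re {z : ℂ} (hz : 1 < z.re) {y : ℝ} (hy : y ∈ Ioo (0:ℝ) 1) :
    HasDerivAt (fun t : ℝ ↦ hurwitzZeta (t : UnitAddCircle) z)
      (-z * hurwitzZeta (y : UnitAddCircle) (z + 1)) y := by
  have hz1 : 1 < (z + 1).re := by simp; linarith
  rw [hurwitzZeta_eq_cpow_add_tsum hy hz1, mul_add, ← tsum_mul_left]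
  have hd : ∀ (n : ℕ), ∀ t ∈ Ioo (0:ℝ) 1, HasDerivAt (fun t : ℝ ↦ ((n + 1 + t : ℝ) : ℂ) ^ (-z))
      (-z * ((n + 1 + t : ℝ) : ℂ) ^ (-(z + 1))) t := fun n t ht ↦ by
    have h0 : (0:ℝ) < n + 1 + t := by have := ht.1; positivity
    exact (hasDerivAt_ofReal_cpow_neg (z := z) h0).comp_const_add ((n:ℝ) + 1) t
  have hS := hasDerivAt_tsum_of_isPreconnected (𝕜 := ℝ) (t := Ioo (0:ℝ) 1)
    (u := fun n : ℕ ↦ ‖z‖ * ((n + 1 : ℕ) : ℝ) ^ (-z.re))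
    ((summable_natCast_succ_rpow hz).mul_left _) isOpen_Ioo isPreconnected_Ioo
    hd (fun n t ht ↦ by
      rw [norm_mul, norm_neg]
      exact mul_le_mul_of_nonneg_left (norm_natCast_add_cpow_le (by linarith) (by simp) ht.1 n) (norm_nonneg _))
    hy (.of_norm_bounded (summable_natCast_succ_rpow hz)
      fun n ↦ norm_natCast_add_cpow_le (by linarith) le_rfl hy.1 n) hy
  refine ((hasDerivAt_ofReal_cpow_neg hy.1).add hS).congr_of_eventuallyEq ?_
  filter_upwards [isOpen_Ioo.mem_nhds hy] with t ht
  exact hurwitzZeta_eq_cpow_add_tsum ht hz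

theorem re_hurwitzZeta_nonneg_of_one_lt {x : ℝ} (hx : 1 < x) {t : ℝ} (ht : t ∈ Ioo (0:ℝ) 1) :
    0 ≤ (hurwitzZeta (t : UnitAddCircle) (x : ℂ)).re := by
  have h := Complex.hasSum_re (hasSum_hurwitzZeta_of_one_lt_re (Ioo_subset_Icc_self ht)
    (s := (x : ℂ)) (by simpa using hx))
  refine h.nonneg fun n ↦ ?_
  have h0 : (0:ℝ) ≤ n + t := by have := ht.1; positivity
  rw [show 1 / ((n : ℂ) + t) ^ (x : ℂ) = ((1 / ((n:ℝ) + t) ^ x : ℝ) : ℂ) by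
    push_cast [Complex.ofReal_cpow h0]; rfl, Complex.ofReal_re]
  positivity

theorem continuous_hurwitzZeta_of_re_neg {z : ℂ} (hz : z.re < 0) :
    Continuous fun t : ℝ ↦ hurwitzZeta (t : UnitAddCircle) z := by
  have h1 : 1 < (1 - z).re := by simp; linarith
  have he : Continuous fun t : ℝ ↦ expZeta (t : UnitAddCircle) (1 - z) := by
    have : (fun t : ℝ ↦ expZeta (t : UnitAddCircle) (1 - z)) = fun t : ℝ ↦
        ∑' n : ℕ, Complex.exp (2 * π * Complex.I * t * n) / n ^ (1 - z) :=
      funext fun t ↦ (hasSum_expZeta_of_one_lt_re t h1).tsum_eq.symm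
    rw [this]
    refine continuous_tsum (fun n ↦ by fun_prop) (Complex.summable_one_div_nat_cpow.2 h1).norm fun n t ↦ ?_
    rw [norm_div, norm_div, norm_one, show 2 * (π : ℂ) * Complex.I * t * n =
      ((2 * π * t * n : ℝ) : ℂ) * Complex.I by push_cast; ring, Complex.norm_exp_ofReal_mul_I]
  have he' : Continuous fun t : ℝ ↦ expZeta (-(t : UnitAddCircle)) (1 - z) := by
    simpa only [Function.comp_def, AddCircle.coe_neg] using he.comp continuous_neg
  have hcomb : ∀ c₁ c₂ c₃ : ℂ, Continuous fun t : ℝ ↦ c₁ * (c₂ * expZeta (t : UnitAddCircle) (1 - z) +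
      c₃ * expZeta (-(t : UnitAddCircle)) (1 - z)) := fun c₁ c₂ c₃ ↦ by fun_prop
  have hfe := fun t : ℝ ↦ hurwitzZeta_one_sub (t : UnitAddCircle) (s := 1 - z)
    (fun n h ↦ by
      rw [h] at h1
      have := n.cast_nonneg (α := ℝ)
      simp at h1; linarith)
    (.inr fun h ↦ by rw [h] at h1; simp at h1)
  simp only [sub_sub_cancel] at hfe
  exact (hcomb _ _ _).congr fun t ↦ (hfe t).symm

/-- The difference `ζ(w, t) - ζ(w, 1/2)`, which is entire in `w`. -/
noncomputable def hurwitzZetaDiff (w : ℂ) (t : ℝ) : ℂ :=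
  hurwitzZeta (t : UnitAddCircle) w - hurwitzZeta ((1 / 2 : ℝ) : UnitAddCircle) w

/-- The function `z ↦ z * ζ(z + 1, 1/2)`, with its removable singularity at `0` filled in. -/
noncomputable def mulHurwitzZetaHalf : ℂ → ℂ :=
  Function.update (fun z ↦ z * hurwitzZeta ((1 / 2 : ℝ) : UnitAddCircle) (z + 1)) 0 1

theorem mulHurwitzZetaHalf_of_ne_zero {z : ℂ} (hz : z ≠ 0) :
    mulHurwitzZetaHalf z = z * hurwitzZeta ((1 / 2 : ℝ) : UnitAddCircle) (z + 1) :=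
  Function.update_of_ne hz _ _

theorem differentiable_mulHurwitzZetaHalf : Differentiable ℂ mulHurwitzZetaHalf := by
  have hne : ∀ z : ℂ, z ≠ 0 → DifferentiableAt ℂ mulHurwitzZetaHalf z := fun z hz ↦ by
    have hd : DifferentiableAt ℂ (fun z ↦ z * hurwitzZeta ((1 / 2 : ℝ) : UnitAddCircle) (z + 1)) z :=
      differentiableAt_id.mul (DifferentiableAt.comp z
        (differentiableAt_hurwitzZeta _ (by simpa using hz)) (by fun_prop))
    refine hd.congr_of_eventuallyEq ?_
    filter_upwards [isOpen_ne.mem_nhds hz] with w hw using mulHurwitzZetaHalf_of_ne_zero hw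
  intro z
  rcases eq_or_ne z 0 with rfl | hz
  · refine (Complex.analyticAt_of_differentiable_on_punctured_nhds_of_continuousAt ?_ ?_).differentiableAt
    · filter_upwards [self_mem_nhdsWithin] with w hw using hne w hw
    · refine continuousAt_update_same.2 ?_
      have ht : Tendsto (fun z : ℂ ↦ z + 1) (𝓝[≠] 0) (𝓝[≠] 1) := by
        refine tendsto_nhdsWithin_iff.2 ⟨?_, ?_⟩
        · have : Tendsto (fun z : ℂ ↦ z + 1) (𝓝 0) (𝓝 (0 + 1)) := (continuous_add_const 1).tendsto 0
          rw [zero_add] at this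
          exact this.mono_left nhdsWithin_le_nhds
        · filter_upwards [self_mem_nhdsWithin] with w hw
          simpa using hw
      simpa [Function.comp_def] using
        (hurwitzZeta_residue_one ((1 / 2 : ℝ) : UnitAddCircle)).comp ht
  · exact hne z hz

theorem half_add_mul_mem_Ioo {s y : ℝ} (hs : s ∈ Icc (0:ℝ) 1) (hy : y ∈ Ioo (0:ℝ) 1) :
    1 / 2 + s * (y - 1 / 2) ∈ Ioo (0:ℝ) 1 := by
  obtain ⟨hs0, hs1⟩ := hs
  obtain ⟨hy0, hy1⟩ := hy
  constructor <;> nlinarith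

theorem continuousOn_hurwitzZetaDiff_of_one_lt_re :
    ContinuousOn (Function.uncurry hurwitzZetaDiff) ({w : ℂ | 1 < w.re} ×ˢ Ioo (0:ℝ) 1) :=
  continuousOn_hurwitzZeta_of_one_lt_re.sub <|
    continuousOn_hurwitzZeta_of_one_lt_re.comp (f := fun p : ℂ × ℝ ↦ (p.1, (1 / 2 : ℝ)))
      (by fun_prop) fun _ hp ↦ ⟨hp.1, by norm_num⟩

theorem continuousOn_hurwitzZetaDiff_segment {σ : ℝ}
    (h : ContinuousOn (Function.uncurry hurwitzZetaDiff) ({w : ℂ | σ < w.re} ×ˢ Ioo (0:ℝ) 1)) :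
    ContinuousOn (fun p : (ℂ × ℝ) × ℝ ↦ hurwitzZetaDiff (p.1.1 + 1) (1 / 2 + p.2 * (p.1.2 - 1 / 2)))
      (({z : ℂ | σ - 1 < z.re} ×ˢ Ioo (0:ℝ) 1) ×ˢ Icc 0 1) :=
  h.comp (f := fun p : (ℂ × ℝ) × ℝ ↦ (p.1.1 + 1, 1 / 2 + p.2 * (p.1.2 - 1 / 2))) (by fun_prop)
    fun p hp ↦ ⟨by have : σ - 1 < p.1.1.re := hp.1.1; simp; linarith,
      half_add_mul_mem_Ioo hp.2 hp.1.2⟩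

theorem hurwitzZetaDiff_eq_of_one_lt_re {z : ℂ} (hz : 1 < z.re) {y : ℝ} (hy : y ∈ Ioo (0:ℝ) 1) :
    hurwitzZetaDiff z y =
      -z * ((y - 1 / 2 : ℝ) * ∫ s in (0:ℝ)..1, hurwitzZetaDiff (z + 1) (1 / 2 + s * (y - 1 / 2))) -
        mulHurwitzZetaHalf z * (y - 1 / 2 : ℝ) := by
  have hz0 : z ≠ 0 := by rintro rfl; norm_num at hz
  have hint : IntervalIntegrable
      (fun s : ℝ ↦ hurwitzZetaDiff (z + 1) (1 / 2 + s * (y - 1 / 2))) volume 0 1 := by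
    refine ContinuousOn.intervalIntegrable ?_
    rw [uIcc_of_le zero_le_one]
    exact (continuousOn_hurwitzZetaDiff_segment continuousOn_hurwitzZetaDiff_of_one_lt_re).comp
      (f := fun s : ℝ ↦ ((z, y), s)) (by fun_prop)
      fun s hs ↦ ⟨⟨by simp; linarith, hy⟩, hs⟩
  have hderiv : ∀ s ∈ uIcc (0:ℝ) 1, HasDerivAt (fun s : ℝ ↦ hurwitzZetaDiff z (1 / 2 + s * (y - 1 / 2)))
      (-z * (y - 1 / 2 : ℝ) * hurwitzZetaDiff (z + 1) (1 / 2 + s * (y - 1 / 2)) -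
        mulHurwitzZetaHalf z * (y - 1 / 2 : ℝ)) s := fun s hs ↦ by
    rw [uIcc_of_le zero_le_one] at hs
    have h1 := hasDerivAt_hurwitzZeta_of_one_lt_re hz (half_add_mul_mem_Ioo hs hy)
    have h2 : HasDerivAt (fun s : ℝ ↦ 1 / 2 + s * (y - 1 / 2)) (y - 1 / 2) s := by
      simpa using ((hasDerivAt_id s).mul_const (y - 1 / 2)).const_add (1 / 2)
    have h3 := (h1.scomp s h2).sub_const (hurwitzZeta ((1 / 2 : ℝ) : UnitAddCircle) z)
    convert! h3 using 1
    rw [mulHurwitzZetaHalf_of_ne_zero hz0, hurwitzZetaDiff, Complex.real_smul]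
    ring
  have hFTC := intervalIntegral.integral_eq_sub_of_hasDerivAt hderiv
    ((hint.const_mul _).sub intervalIntegrable_const)
  rw [intervalIntegral.integral_sub (hint.const_mul _) intervalIntegrable_const,
    intervalIntegral.integral_const_mul, intervalIntegral.integral_const] at hFTC
  have h0 : hurwitzZetaDiff z (1 / 2 + 0 * (y - 1 / 2)) = 0 := by simp [hurwitzZetaDiff]
  rw [h0, show 1 / 2 + 1 * (y - 1 / 2) = y by ring] at hFTC
  simp only [sub_zero, one_smul] at hFTC
  rw [← hFTC]
  ring

theorem hurwitzZetaDiff_eq_of_continuousOn {σ : ℝ} (hσ : σ ≤ 1)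
    (h : ContinuousOn (Function.uncurry hurwitzZetaDiff) ({w : ℂ | σ < w.re} ×ˢ Ioo (0:ℝ) 1))
    {z : ℂ} (hz : σ - 1 < z.re) {y : ℝ} (hy : y ∈ Ioo (0:ℝ) 1) :
    hurwitzZetaDiff z y =
      -z * ((y - 1 / 2 : ℝ) * ∫ s in (0:ℝ)..1, hurwitzZetaDiff (z + 1) (1 / 2 + s * (y - 1 / 2))) -
        mulHurwitzZetaHalf z * (y - 1 / 2 : ℝ) := by
  have hU : IsOpen {z : ℂ | σ - 1 < z.re} := isOpen_lt continuous_const Complex.continuous_re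
  have hI := differentiableOn_intervalIntegral hU
    (F := fun z s ↦ hurwitzZetaDiff (z + 1) (1 / 2 + s * (y - 1 / 2)))
    ((continuousOn_hurwitzZetaDiff_segment h).comp (f := fun p : ℂ × ℝ ↦ ((p.1, y), p.2))
      (by fun_prop) fun p hp ↦ ⟨⟨hp.1, hy⟩, hp.2⟩)
    fun s _ ↦ ((differentiable_hurwitzZeta_sub_hurwitzZeta _ _).comp
      (differentiable_id.add_const (1 : ℂ))).differentiableOn
  have hR : DifferentiableOn ℂ (fun z ↦ -z * ((y - 1 / 2 : ℝ) *
      ∫ s in (0:ℝ)..1, hurwitzZetaDiff (z + 1) (1 / 2 + s * (y - 1 / 2))) -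
        mulHurwitzZetaHalf z * (y - 1 / 2 : ℝ)) {z : ℂ | σ - 1 < z.re} :=
    (differentiableOn_id.neg.mul (hI.const_mul _)).sub
      (differentiable_mulHurwitzZetaHalf.mul_const _).differentiableOn
  have hL : DifferentiableOn ℂ (fun z ↦ hurwitzZetaDiff z y) {z : ℂ | σ - 1 < z.re} :=
    (differentiable_hurwitzZeta_sub_hurwitzZeta _ _).differentiableOn
  refine (hL.analyticOnNhd hU).eqOn_of_preconnected_of_eventuallyEq (hR.analyticOnNhd hU)
    (convex_halfSpace_re_gt _).isPreconnected (z₀ := 2) (by simp; linarith) ?_ hz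
  filter_upwards [(isOpen_lt continuous_const Complex.continuous_re).mem_nhds
    (by simp : (2 : ℂ) ∈ {z : ℂ | 1 < z.re})] with w hw using hurwitzZetaDiff_eq_of_one_lt_re hw hy

theorem continuousOn_hurwitzZetaDiff_sub_one {σ : ℝ} (hσ : σ ≤ 1)
    (h : ContinuousOn (Function.uncurry hurwitzZetaDiff) ({w : ℂ | σ < w.re} ×ˢ Ioo (0:ℝ) 1)) :
    ContinuousOn (Function.uncurry hurwitzZetaDiff) ({w : ℂ | σ - 1 < w.re} ×ˢ Ioo (0:ℝ) 1) := by
  have hI : ContinuousOn (fun p : ℂ × ℝ ↦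
      ∫ s in (0:ℝ)..1, hurwitzZetaDiff (p.1 + 1) (1 / 2 + s * (p.2 - 1 / 2)))
      ({w : ℂ | σ - 1 < w.re} ×ˢ Ioo (0:ℝ) 1) := by
    rw [continuousOn_iff_continuous_domRestrict]
    exact continuous_intervalIntegral_of_continuousOn
      (F := fun (p : ({w : ℂ | σ - 1 < w.re} ×ˢ Ioo (0:ℝ) 1 : Set (ℂ × ℝ))) (s : ℝ) ↦
        hurwitzZetaDiff (p.1.1 + 1) (1 / 2 + s * (p.1.2 - 1 / 2)))
      ((continuousOn_hurwitzZetaDiff_segment h).comp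
        (f := fun q : ({w : ℂ | σ - 1 < w.re} ×ˢ Ioo (0:ℝ) 1 : Set (ℂ × ℝ)) × ℝ ↦ (q.1.1, q.2))
        (by fun_prop) fun q hq ↦ ⟨q.1.2, hq.2⟩)
  have hR := differentiable_mulHurwitzZetaHalf.continuous
  refine ContinuousOn.congr (f := fun p : ℂ × ℝ ↦ -p.1 * ((p.2 - 1 / 2 : ℝ) *
      ∫ s in (0:ℝ)..1, hurwitzZetaDiff (p.1 + 1) (1 / 2 + s * (p.2 - 1 / 2))) -
        mulHurwitzZetaHalf p.1 * (p.2 - 1 / 2 : ℝ)) ?_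
    fun p hp ↦ hurwitzZetaDiff_eq_of_continuousOn hσ h hp.1 hp.2
  exact (ContinuousOn.mul (by fun_prop) (ContinuousOn.mul (by fun_prop) hI)).sub
    ((hR.comp continuous_fst).mul (by fun_prop)).continuousOn

theorem continuousOn_hurwitzZetaDiff (k : ℕ) :
    ContinuousOn (Function.uncurry hurwitzZetaDiff) ({w : ℂ | 1 - (k : ℝ) < w.re} ×ˢ Ioo (0:ℝ) 1) := by
  induction k with
  | zero => simpa using continuousOn_hurwitzZetaDiff_of_one_lt_re
  | succ k ih =>
    have := continuousOn_hurwitzZetaDiff_sub_one (by have := k.cast_nonneg (α := ℝ); linarith) ih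
    rwa [show (1:ℝ) - k - 1 = 1 - ((k + 1 : ℕ) : ℝ) by push_cast; ring] at this

theorem continuousOn_hurwitzZetaDiff_right (w : ℂ) :
    ContinuousOn (hurwitzZetaDiff w) (Ioo (0:ℝ) 1) := by
  obtain ⟨k, hk⟩ := exists_nat_gt (1 - w.re)
  exact (continuousOn_hurwitzZetaDiff k).comp (f := fun t : ℝ ↦ (w, t)) (by fun_prop)
    fun t ht ↦ ⟨by simp; linarith, ht⟩

/-- The derivative of the Hurwitz zeta function in its second argument, for all `z ≠ 0`. -/
theorem hasDerivAt_hurwitzZeta {z : ℂ} (hz : z ≠ 0) {y : ℝ} (hy : y ∈ Ioo (0:ℝ) 1) :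
    HasDerivAt (fun t : ℝ ↦ hurwitzZeta (t : UnitAddCircle) z)
      (-z * hurwitzZeta (y : UnitAddCircle) (z + 1)) y := by
  obtain ⟨k, hk⟩ := exists_nat_gt (-z.re)
  have heq : ∀ t ∈ Ioo (0:ℝ) 1, hurwitzZeta (t : UnitAddCircle) z =
      -z * (∫ s in (1 / 2 : ℝ)..t, hurwitzZetaDiff (z + 1) s) -
        mulHurwitzZetaHalf z * (t - 1 / 2 : ℝ) + hurwitzZeta ((1 / 2 : ℝ) : UnitAddCircle) z := by
    intro t ht
    have h := hurwitzZetaDiff_eq_of_continuousOn (by have := k.cast_nonneg (α := ℝ); linarith)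
      (continuousOn_hurwitzZetaDiff k) (by linarith) ht
    have hcv := intervalIntegral.smul_integral_comp_add_mul (a := 0) (b := 1)
      (hurwitzZetaDiff (z + 1)) (t - 1 / 2) (1 / 2)
    rw [mul_zero, add_zero, mul_one, add_sub_cancel, Complex.real_smul] at hcv
    simp only [mul_comm _ (t - 1 / 2)] at h
    rw [hcv] at h
    rw [← h, hurwitzZetaDiff, sub_add_cancel]
  have hc := continuousOn_hurwitzZetaDiff_right (z + 1)
  have hsub : uIcc (1 / 2) y ⊆ Ioo (0:ℝ) 1 :=
    (convex_Ioo (0:ℝ) 1).ordConnected.uIcc_subset (by norm_num) hy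
  have hFTC := intervalIntegral.integral_hasDerivAt_right (hc.mono hsub).intervalIntegrable
    (hc.stronglyMeasurableAtFilter isOpen_Ioo y hy) (hc.continuousAt (isOpen_Ioo.mem_nhds hy))
  have hlin : HasDerivAt (fun t : ℝ ↦ ((t - 1 / 2 : ℝ) : ℂ)) 1 y := by
    exact_mod_cast ((hasDerivAt_id y).sub_const (1 / 2)).ofReal_comp
  have h := ((hFTC.const_mul (-z)).sub (hlin.const_mul (mulHurwitzZetaHalf z))).add_const
    (hurwitzZeta ((1 / 2 : ℝ) : UnitAddCircle) z)
  convert! h.congr_of_eventuallyEq ?_ using 1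
  · rw [mulHurwitzZetaHalf_of_ne_zero hz, hurwitzZetaDiff]
    ring
  · filter_upwards [isOpen_Ioo.mem_nhds hy] with t ht using heq t ht

theorem intervalIntegrable_of_antitoneOn_deriv {g g' : ℝ → ℝ} (hg : ContinuousOn g (Icc 0 1))
    (hd : ∀ x ∈ Ioo (0:ℝ) 1, HasDerivAt g (g' x) x) (hg' : AntitoneOn g' (Ioo 0 1)) :
    IntervalIntegrable g' volume 0 1 := by
  have hhalf : (1 / 2 : ℝ) ∈ Ioo (0:ℝ) 1 := by norm_num
  have hlin : ∀ x, HasDerivAt (fun x : ℝ ↦ g' (1 / 2) * x) (g' (1 / 2)) x := fun x ↦ by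
    simpa using (hasDerivAt_id x).const_mul (g' (1 / 2))
  have hleft : IntervalIntegrable (fun x ↦ g' x - g' (1 / 2)) volume 0 (1 / 2) := by
    rw [intervalIntegrable_iff_integrableOn_Ioc_of_le (by norm_num)]
    refine intervalIntegral.integrableOn_deriv_of_nonneg (g := fun x ↦ g x - g' (1 / 2) * x)
      ((hg.mono (Icc_subset_Icc_right (by norm_num))).sub (by fun_prop))
      (fun x hx ↦ (hd x ⟨hx.1, by linarith [hx.2]⟩).sub (hlin x)) fun x hx ↦ ?_
    exact sub_nonneg.2 (hg' ⟨hx.1, by linarith [hx.2]⟩ hhalf hx.2.le)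
  have hright : IntervalIntegrable (fun x ↦ g' (1 / 2) - g' x) volume (1 / 2) 1 := by
    rw [intervalIntegrable_iff_integrableOn_Ioc_of_le (by norm_num)]
    refine intervalIntegral.integrableOn_deriv_of_nonneg (g := fun x ↦ g' (1 / 2) * x - g x)
      (ContinuousOn.sub (by fun_prop) (hg.mono (Icc_subset_Icc_left (by norm_num))))
      (fun x hx ↦ (hlin x).sub (hd x ⟨by linarith [hx.1], hx.2⟩)) fun x hx ↦ ?_
    exact sub_nonneg.2 (hg' hhalf ⟨by linarith [hx.1], hx.2⟩ hx.1.le)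
  refine IntervalIntegrable.trans (b := 1 / 2) ?_ ?_
  · simpa using hleft.add (intervalIntegrable_const (c := g' (1 / 2)))
  · simpa using (intervalIntegrable_const (c := g' (1 / 2))).sub hright

theorem hasDerivAt_hzeta {b : ℝ} (hb : b ≠ 1) {y : ℝ} (hy : y ∈ Ioo (0:ℝ) 1) :
    HasDerivAt (hzeta (1 - b)) ((b - 1) * hzeta (1 - (b - 1)) y) y := by
  have hz : ((1 - b : ℝ) : ℂ) ≠ 0 := Complex.ofReal_ne_zero.2 (sub_ne_zero.2 hb.symm)
  have h := Complex.reCLM.hasFDerivAt.comp_hasDerivAt y (hasDerivAt_hurwitzZeta hz hy)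
  convert! h using 1
  rw [hzeta, show ((1 - (b - 1) : ℝ) : ℂ) = ((1 - b : ℝ) : ℂ) + 1 by push_cast; ring,
    Complex.reCLM_apply, ← Complex.ofReal_neg, Complex.re_ofReal_mul]
  ring

theorem continuous_hzeta_one_sub {b : ℝ} (hb : 1 < b) : Continuous (hzeta (1 - b)) :=
  Complex.continuous_re.comp (continuous_hurwitzZeta_of_re_neg (by simpa using hb))

theorem hzeta_one_eq_hzeta_zero (z : ℝ) : hzeta z 1 = hzeta z 0 := by
  rw [hzeta, hzeta, AddCircle.coe_period, AddCircle.coe_zero]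

theorem antitoneOn_hzeta_one_sub {b : ℝ} (hb0 : 0 < b) (hb1 : b ≤ 1) :
    AntitoneOn (hzeta (1 - b)) (Ioo 0 1) := by
  have hlt : ∀ b : ℝ, 0 < b → b < 1 → AntitoneOn (hzeta (1 - b)) (Ioo 0 1) := fun b hb0 hb1 ↦ by
    refine antitoneOn_of_deriv_nonpos (convex_Ioo 0 1)
      (fun y hy ↦ (hasDerivAt_hzeta hb1.ne hy).continuousAt.continuousWithinAt)
      (fun y hy ↦ ?_) fun y hy ↦ ?_
    · rw [interior_Ioo] at hy
      exact (hasDerivAt_hzeta hb1.ne hy).differentiableAt.differentiableWithinAt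
    · rw [interior_Ioo] at hy
      rw [(hasDerivAt_hzeta hb1.ne hy).deriv]
      exact mul_nonpos_of_nonpos_of_nonneg (by linarith)
        (re_hurwitzZeta_nonneg_of_one_lt (by linarith) hy)
  rcases hb1.lt_or_eq with hb1 | rfl
  · exact hlt b hb0 hb1
  intro x hx y hy hxy
  have hlim : ∀ t : ℝ, Tendsto (fun b : ℝ ↦ hzeta (1 - b) t) (𝓝[<] 1) (𝓝 (hzeta (1 - 1) t)) := by
    intro t
    have hc : ContinuousAt (fun b : ℝ ↦ hzeta (1 - b) t) 1 := by
      refine Complex.continuous_re.continuousAt.comp (ContinuousAt.comp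
        (g := hurwitzZeta (t : UnitAddCircle)) (f := fun b : ℝ ↦ ((1 - b : ℝ) : ℂ))
        (differentiableAt_hurwitzZeta _ (by simp)).continuousAt (by fun_prop))
    exact hc.tendsto.mono_left nhdsWithin_le_nhds
  refine le_of_tendsto_of_tendsto (hlim y) (hlim x) ?_
  filter_upwards [Ioo_mem_nhdsLT (zero_lt_one' ℝ)] with b hb using hlt b hb.1 hb.2 hx hy hxy

theorem intervalIntegrable_hzeta_one_sub {b : ℝ} (hb : 0 < b) :
    IntervalIntegrable (hzeta (1 - b)) volume 0 1 := by
  rcases lt_or_ge 1 b with hb1 | hb1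
  · exact (continuous_hzeta_one_sub hb1).intervalIntegrable 0 1
  have h := intervalIntegrable_of_antitoneOn_deriv (g := fun y ↦ hzeta (1 - (b + 1)) y / b)
    (g' := hzeta (1 - b)) ((continuous_hzeta_one_sub (by linarith)).div_const b).continuousOn
    (fun y hy ↦ ?_) (antitoneOn_hzeta_one_sub hb hb1)
  · exact h
  · have := (hasDerivAt_hzeta (b := b + 1) (by linarith) hy).div_const b
    rwa [add_sub_cancel_right, mul_div_cancel_left₀ _ hb.ne'] at this

/-- Integration by parts on `[0, 1]` for a product of three functions with vanishing boundary terms. -/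
theorem integral_mul_deriv_mul_eq {u v w u' v' w' : ℝ → ℝ}
    (hu : Continuous u) (hv : Continuous v) (hw : Continuous w)
    (hu' : ∀ x ∈ Ioo (0:ℝ) 1, HasDerivAt u (u' x) x) (hv' : ∀ x ∈ Ioo (0:ℝ) 1, HasDerivAt v (v' x) x)
    (hw' : ∀ x ∈ Ioo (0:ℝ) 1, HasDerivAt w (w' x) x)
    (hui : IntervalIntegrable u' volume 0 1) (hvi : IntervalIntegrable v' volume 0 1)
    (hwi : IntervalIntegrable w' volume 0 1)
    (hu01 : u 1 = u 0) (hv01 : v 1 = v 0) (hw01 : w 1 = w 0) :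
    ∫ x in (0:ℝ)..1, u x * v' x * w x =
      -((∫ x in (0:ℝ)..1, u' x * v x * w x) + ∫ x in (0:ℝ)..1, u x * v x * w' x) := by
  have h1 : IntervalIntegrable (fun x ↦ u' x * v x * w x) volume 0 1 :=
    (hui.mul_continuousOn hv.continuousOn).mul_continuousOn hw.continuousOn
  have h2 : IntervalIntegrable (fun x ↦ u x * v' x * w x) volume 0 1 :=
    (hvi.continuousOn_mul hu.continuousOn).mul_continuousOn hw.continuousOn
  have h3 : IntervalIntegrable (fun x ↦ u x * v x * w' x) volume 0 1 :=
    hwi.continuousOn_mul (hu.mul hv).continuousOn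
  have hFTC := intervalIntegral.integral_eq_sub_of_hasDerivAt_of_le (zero_le_one' ℝ)
    ((hu.mul hv).mul hw).continuousOn
    (f' := fun x ↦ u' x * v x * w x + u x * v' x * w x + u x * v x * w' x)
    (fun x hx ↦ by
      convert! ((hu' x hx).mul (hv' x hx)).mul (hw' x hx) using 1
      simp only [Pi.mul_apply]
      ring)
    ((h1.add h2).add h3)
  rw [intervalIntegral.integral_add (h1.add h2) h3, intervalIntegral.integral_add h1 h2] at hFTC
  simp only [Pi.mul_apply, hu01, hv01, hw01, sub_self] at hFTC
  linarith

theorem IJ_recursion_once (ε a c : ℝ) (hε : 0 < ε) (ha : 1 < a) (hc : 1 < c) :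
    Iint a ε c = -(1 / ε) * ((a - 1) * Iint (a - 1) (ε + 1) c + (c - 1) * Iint a (ε + 1) (c - 1)) ∧
    Jint a ε c = -(1 / ε) * ((a - 1) * Jint (a - 1) (ε + 1) c - (c - 1) * Jint a (ε + 1) (c - 1)) := by
  have hεne : ε + 1 ≠ 1 := by linarith
  have hfε : Continuous (hzeta (1 - (ε + 1))) := continuous_hzeta_one_sub (by linarith)
  have hfa := continuous_hzeta_one_sub ha
  have hfc := continuous_hzeta_one_sub hc
  have hia := intervalIntegrable_hzeta_one_sub (sub_pos.2 ha)
  have hic := intervalIntegrable_hzeta_one_sub (sub_pos.2 hc)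
  have hdε : ∀ x ∈ Ioo (0:ℝ) 1, HasDerivAt (hzeta (1 - (ε + 1))) (ε * hzeta (1 - ε) x) x :=
    fun x hx ↦ by simpa using hasDerivAt_hzeta hεne hx
  have hiε := (intervalIntegrable_hzeta_one_sub hε).const_mul ε
  constructor
  · have h := integral_mul_deriv_mul_eq hfa hfε hfc (fun x hx ↦ hasDerivAt_hzeta ha.ne' hx) hdε
      (fun x hx ↦ hasDerivAt_hzeta hc.ne' hx) (hia.const_mul _) hiε (hic.const_mul _)
      (hzeta_one_eq_hzeta_zero _) (hzeta_one_eq_hzeta_zero _) (hzeta_one_eq_hzeta_zero _)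
    have h' : ε * Iint a ε c =
        -((a - 1) * Iint (a - 1) (ε + 1) c + (c - 1) * Iint a (ε + 1) (c - 1)) := by
      simp only [Iint, ← intervalIntegral.integral_const_mul]
      refine Eq.trans ?_ (h.trans (congrArg Neg.neg (congrArg₂ (· + ·) ?_ ?_))) <;>
        exact intervalIntegral.integral_congr fun x _ ↦ by ring
    field_simp
    linarith
  · have hrefl : ∀ x ∈ Ioo (0:ℝ) 1, 1 - x ∈ Ioo (0:ℝ) 1 :=
      fun x hx ↦ ⟨by linarith [hx.2], by linarith [hx.1]⟩
    have hic' : IntervalIntegrable (fun x ↦ hzeta (1 - (c - 1)) (1 - x)) volume 0 1 := by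
      simpa using (hic.comp_sub_left 1).symm
    have h := integral_mul_deriv_mul_eq hfa hfε (w := fun x ↦ hzeta (1 - c) (1 - x))
      (w' := fun x ↦ -((c - 1) * hzeta (1 - (c - 1)) (1 - x)))
      (hfc.comp (continuous_const.sub continuous_id))
      (fun x hx ↦ hasDerivAt_hzeta ha.ne' hx) hdε
      (fun x hx ↦ (hasDerivAt_hzeta hc.ne' (hrefl x hx)).comp_const_sub 1 x)
      (hia.const_mul _) hiε (hic'.const_mul _).neg
      (hzeta_one_eq_hzeta_zero _) (hzeta_one_eq_hzeta_zero _)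
      (by simp [hzeta_one_eq_hzeta_zero])
    have h' : ε * Jint a ε c =
        -((a - 1) * Jint (a - 1) (ε + 1) c + -((c - 1) * Jint a (ε + 1) (c - 1))) := by
      simp only [Jint, ← intervalIntegral.integral_const_mul, ← intervalIntegral.integral_neg]
      refine Eq.trans ?_ (h.trans (congrArg Neg.neg (congrArg₂ (· + ·) ?_ ?_))) <;>
        exact intervalIntegral.integral_congr fun x _ ↦ by ring
    field_simp
    linarith
end
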